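/- arXiv:math/0012006 — 7 statements merged into one kernel-verified Lean document; each statement's English description precedes it below -/
import Mathlib

section
/- Let X be a discrete metric space of bounded geometry (for every R > 0 there is a constant c(R) such that every ball of radius R in X contains at most c(R) points) with asdim X ≤ n, and let f_α : F_α → X be a family of injective 1-Lipschitz maps from metric spaces F_α to X. Then the family {F_α} satisfies asdim F_α ≤ n uniformly. -/
/-- `AsdimOnLE dist A n` : the subset `A` of a space with distance function `dist`
has asymptotic dimension at most `n`. -/
def AsdimOnLE {X : Type*} (dist : X → X → ℝ) (A : Set X) (n : ℕ) : Prop :=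
  ∀ d : ℝ, 0 < d → ∃ R : ℝ, ∃ 𝒰 : Fin (n + 1) → Set (Set X),
    (∀ i, ∀ U ∈ 𝒰 i, U ⊆ A) ∧
    (∀ x ∈ A, ∃ i, ∃ U ∈ 𝒰 i, x ∈ U) ∧
    (∀ i, ∀ U ∈ 𝒰 i, ∀ V ∈ 𝒰 i, U ≠ V → ∀ x ∈ U, ∀ y ∈ V, d ≤ dist x y) ∧
    (∀ i, ∀ U ∈ 𝒰 i, ∀ x ∈ U, ∀ y ∈ U, dist x y ≤ R)

/-- A family of metric spaces `F α` satisfies `asdim F α ≤ n` *uniformly* if for every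
`d > 0` there is a common bound `R` such that each `F α` admits `n+1` `d`-disjoint,
`R`-bounded families of subsets covering `F α`. -/
def AsdimUnifLE {ι : Type*} (F : ι → Type*) [∀ α, MetricSpace (F α)] (n : ℕ) : Prop :=
  ∀ d : ℝ, 0 < d → ∃ R : ℝ, ∀ α : ι, ∃ 𝒰 : Fin (n + 1) → Set (Set (F α)),
    (∀ x : F α, ∃ i, ∃ U ∈ 𝒰 i, x ∈ U) ∧
    (∀ i, ∀ U ∈ 𝒰 i, ∀ V ∈ 𝒰 i, U ≠ V → ∀ x ∈ U, ∀ y ∈ V, d ≤ dist x y) ∧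
    (∀ i, ∀ U ∈ 𝒰 i, ∀ x ∈ U, ∀ y ∈ U, dist x y ≤ R)

/-- The graph on `S` joining distinct points at distance less than `d`. -/
def chainGraph {M : Type*} [MetricSpace M] (S : Set M) (d : ℝ) : SimpleGraph S where
  Adj x y := x ≠ y ∧ dist (x : M) y < d
  symm := ⟨fun x y h => ⟨h.1.symm, by rw [dist_comm]; exact h.2⟩⟩
  loopless := ⟨fun x h => h.1 rfl⟩

/-- The component of `a` in `S` under chains with steps less than `d`. -/
def chainComp {M : Type*} [MetricSpace M] (S : Set M) (d : ℝ) (a : S) : Set M :=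
  {y | ∃ hy : y ∈ S, (chainGraph S d).Reachable a ⟨y, hy⟩}

lemma chainGraph_walk_dist {M : Type*} [MetricSpace M] (S : Set M) (d : ℝ) {x y : S}
    (p : (chainGraph S d).Walk x y) : dist (x : M) y ≤ p.length * d := by
  induction p with
  | nil => simp
  | @cons u v w h p ih =>
    have h1 := dist_triangle (u : M) v w
    have h2 : dist (u : M) v < d := h.2
    rw [SimpleGraph.Walk.length_cons]
    push_cast
    linarith

lemma chainGraph_reachable_dist {M : Type*} [MetricSpace M] (S : Set M) (d : ℝ) (hd : 0 < d)
    (hS : S.Finite) (c : ℕ) (hc : S.ncard ≤ c) {x y : S}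
    (h : (chainGraph S d).Reachable x y) : dist (x : M) y ≤ c * d := by
  classical
  haveI : Fintype S := hS.fintype
  obtain ⟨p, hp⟩ := h.exists_isPath
  have h1 := hp.length_lt
  have h2 : Fintype.card S = S.ncard := by
    rw [← Nat.card_eq_fintype_card]; rfl
  have h3 : p.length ≤ c := by omega
  refine (chainGraph_walk_dist S d p).trans ?_
  gcongr

/-- **Proposition 1.** Let `X` be a discrete metric space of bounded geometry (every
`R`-ball contains at most `c R` points) with `asdim X ≤ n`, and let `f α : F α → X` be a
family of injective `1`-Lipschitz maps.  Then `asdim F α ≤ n` uniformly. -/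
theorem asdimUnifLE_of_lipschitz_injective {X : Type*} [MetricSpace X]
    {ι : Type*} (F : ι → Type*) [∀ α, MetricSpace (F α)] (n : ℕ)
    (hbg : ∀ R : ℝ, 0 < R → ∃ c : ℕ, ∀ x : X, (Metric.closedBall x R).Finite ∧
      (Metric.closedBall x R).ncard ≤ c)
    (hX : AsdimOnLE dist (Set.univ : Set X) n)
    (f : ∀ α, F α → X)
    (hinj : ∀ α, Function.Injective (f α))
    (hlip : ∀ α, LipschitzWith 1 (f α)) :
    AsdimUnifLE F n := by
  intro d hd
  obtain ⟨R, 𝒰, -, hcov, hdis, hbd⟩ := hX d hd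
  obtain ⟨c, hc⟩ := hbg (max R 1) (by positivity)
  refine ⟨c * d, fun α => ⟨fun i => {C | ∃ U ∈ 𝒰 i, ∃ a : (f α ⁻¹' U : Set (F α)),
    C = chainComp (f α ⁻¹' U) d a}, ?_, ?_, ?_⟩⟩
  · intro x
    obtain ⟨i, U, hU, hx⟩ := hcov (f α x) trivial
    exact ⟨i, _, ⟨U, hU, ⟨x, hx⟩, rfl⟩, hx, SimpleGraph.Reachable.refl _⟩
  · rintro i _ ⟨U, hU, a, rfl⟩ _ ⟨V, hV, b, rfl⟩ hne x ⟨hx, hax⟩ y ⟨hy, hby⟩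
    by_cases hUV : U = V
    · subst hUV
      by_contra hlt
      push Not at hlt
      apply hne
      have hxy : (chainGraph (f α ⁻¹' U) d).Reachable ⟨x, hx⟩ ⟨y, hy⟩ := by
        by_cases he : x = y
        · subst he; exact SimpleGraph.Reachable.refl _
        · exact SimpleGraph.Adj.reachable ⟨fun h => he (congrArg Subtype.val h), hlt⟩
      have hab := (hax.trans hxy).trans hby.symm
      ext z
      exact ⟨fun ⟨hz, h⟩ => ⟨hz, hab.symm.trans h⟩, fun ⟨hz, h⟩ => ⟨hz, hab.trans h⟩⟩
    · have h1 := hdis i U hU V hV hUV _ hx _ hy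
      have h2 := (hlip α).dist_le_mul x y
      simp only [NNReal.coe_one, one_mul] at h2
      exact h1.trans h2
  · rintro i _ ⟨U, hU, a, rfl⟩ x ⟨hx, hax⟩ y ⟨hy, hay⟩
    have hsub : U ⊆ Metric.closedBall (f α x) (max R 1) := fun z hz =>
      (hbd i U hU z hz _ hx).trans (le_max_left _ _)
    obtain ⟨hfin, hcard⟩ := hc (f α x)
    have hUf := hfin.subset hsub
    have hS : (f α ⁻¹' U).Finite := hUf.preimage (hinj α).injOn
    have hSc : (f α ⁻¹' U).ncard ≤ c := by
      refine le_trans ?_ ((Set.ncard_le_ncard hsub hfin).trans hcard)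
      exact Set.ncard_le_ncard_of_injOn (f α) (fun z hz => hz) (hinj α).injOn hUf
    exact chainGraph_reachable_dist _ d hd hS c hSc (hax.symm.trans hay)
end

section
/- Let X be a metric space with X = ∪_α F_α, where the family {F_α} of subspaces satisfies asdim F_α ≤ n uniformly. Suppose that for every r > 0 there exists a subset Y_r ⊆ X with asdim Y_r ≤ n such that the family {F_α \ Y_r} is r-disjoint (any two of these sets indexed by distinct α are at distance ≥ r from each other). Then asdim X ≤ n. -/
/-- A family of subspaces `F α ⊆ X` satisfies `asdim (F α) ≤ n` *uniformly* if for every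
`d > 0` there is a common bound `R` such that each `F α` admits `n+1` `d`-disjoint,
`R`-bounded families of subsets covering `F α`. -/
def AsdimUnifOnLE {X ι : Type*} (dist : X → X → ℝ) (F : ι → Set X) (n : ℕ) : Prop :=
  ∀ d : ℝ, 0 < d → ∃ R : ℝ, ∀ α : ι, ∃ 𝒰 : Fin (n + 1) → Set (Set X),
    (∀ i, ∀ U ∈ 𝒰 i, U ⊆ F α) ∧
    (∀ x ∈ F α, ∃ i, ∃ U ∈ 𝒰 i, x ∈ U) ∧
    (∀ i, ∀ U ∈ 𝒰 i, ∀ V ∈ 𝒰 i, U ≠ V → ∀ x ∈ U, ∀ y ∈ V, d ≤ dist x y) ∧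
    (∀ i, ∀ U ∈ 𝒰 i, ∀ x ∈ U, ∀ y ∈ U, dist x y ≤ R)

/-- **Theorem 1 (Countable Union Theorem).** Suppose `X = ⋃ α, F α` with
`asdim (F α) ≤ n` uniformly, and for every `r > 0` there is `Y_r ⊆ X` with
`asdim Y_r ≤ n` such that the family `{F α \ Y_r}` is `r`-disjoint.
Then `asdim X ≤ n`. -/
theorem countable_union_theorem {X : Type*} [MetricSpace X] {ι : Type*}
    (F : ι → Set X) (n : ℕ)
    (hcover : (⋃ α, F α) = Set.univ)
    (hunif : AsdimUnifOnLE dist F n)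
    (hY : ∀ r : ℝ, 0 < r → ∃ Y : Set X, AsdimOnLE dist Y n ∧
      ∀ α β : ι, α ≠ β → ∀ x ∈ F α \ Y, ∀ y ∈ F β \ Y, r ≤ dist x y) :
    AsdimOnLE dist (Set.univ : Set X) n := by
  intro d hd
  obtain ⟨R, hR⟩ := hunif d hd
  choose 𝒰 hsub hcov hdisj hbd using hR
  obtain ⟨Y, hYdim, hYd⟩ := hY d hd
  set T : ℝ := max R 0 with hT
  have hT0 : 0 ≤ T := le_max_right _ _
  have hRT : R ≤ T := le_max_left _ _
  obtain ⟨S, 𝒱, -, hVcov, hVdisj, hVbd⟩ := hYdim (3 * d + 2 * T) (by positivity)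
  -- the trimmed families
  let 𝒲 : Fin (n + 1) → Set (Set X) := fun i => {W | ∃ α, ∃ U ∈ 𝒰 α i, W = U \ Y}
  have hWdisj : ∀ i, ∀ U ∈ 𝒲 i, ∀ V ∈ 𝒲 i, U ≠ V → ∀ x ∈ U, ∀ y ∈ V, d ≤ dist x y := by
    rintro i _ ⟨α, U, hU, rfl⟩ _ ⟨β, V, hV, rfl⟩ hne x hx y hy
    by_cases hab : α = β
    · subst hab
      exact hdisj α i U hU V hV (fun h => hne (by rw [h])) x hx.1 y hy.1
    · exact hYd α β hab x ⟨hsub α i U hU hx.1, hx.2⟩ y ⟨hsub β i V hV hy.1, hy.2⟩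
  have hWbd : ∀ i, ∀ U ∈ 𝒲 i, ∀ x ∈ U, ∀ y ∈ U, dist x y ≤ T := by
    rintro i _ ⟨α, U, hU, rfl⟩ x hx y hy
    exact (hbd α i U hU x hx.1 y hy.1).trans hRT
  let near : Set X → Set X → Prop := fun V W => ∃ v ∈ V, ∃ w ∈ W, dist v w < d
  let N : Fin (n + 1) → Set X → Set X := fun i V =>
    {x | x ∈ V ∨ ∃ W ∈ 𝒲 i, near V W ∧ x ∈ W}
  have hN : ∀ i V, ∀ x ∈ N i V, ∃ v ∈ V, dist x v ≤ d + T := by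
    rintro i V x (hx | ⟨W, hW, ⟨v, hv, w, hw, hvw⟩, hx⟩)
    · exact ⟨x, hx, by rw [dist_self]; positivity⟩
    · refine ⟨v, hv, ?_⟩
      have h1 := hWbd i W hW x hx w hw
      have h2 := dist_triangle x w v
      rw [dist_comm w v] at h2
      linarith
  have hmix : ∀ i V W, W ∈ 𝒲 i → ¬ near V W → ∀ x ∈ N i V, ∀ y ∈ W, d ≤ dist x y := by
    rintro i V W hW hfar x (hx | ⟨W', hW', hn, hx⟩) y hy
    · by_contra hlt
      exact hfar ⟨x, hx, y, hy, not_le.mp hlt⟩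
    · exact hWdisj i W' hW' W hW (fun h => hfar (h ▸ hn)) x hx y hy
  refine ⟨max T (S + 2 * (d + T)), fun i =>
    {A | (∃ V ∈ 𝒱 i, A = N i V) ∨ (A ∈ 𝒲 i ∧ ∀ V ∈ 𝒱 i, ¬ near V A)},
    fun _ _ _ => Set.subset_univ _, ?_, ?_, ?_⟩
  · intro x _
    by_cases hxY : x ∈ Y
    · obtain ⟨i, V, hV, hx⟩ := hVcov x hxY
      exact ⟨i, N i V, Or.inl ⟨V, hV, rfl⟩, Or.inl hx⟩
    · have hx : x ∈ ⋃ α, F α := hcover ▸ Set.mem_univ x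
      obtain ⟨α, hα⟩ := Set.mem_iUnion.mp hx
      obtain ⟨i, U, hU, hxU⟩ := hcov α x hα
      have hW : U \ Y ∈ 𝒲 i := ⟨α, U, hU, rfl⟩
      by_cases h : ∃ V ∈ 𝒱 i, near V (U \ Y)
      · obtain ⟨V, hV, hn⟩ := h
        exact ⟨i, N i V, Or.inl ⟨V, hV, rfl⟩, Or.inr ⟨U \ Y, hW, hn, hxU, hxY⟩⟩
      · exact ⟨i, U \ Y, Or.inr ⟨hW, fun V hV hn => h ⟨V, hV, hn⟩⟩, hxU, hxY⟩
  · rintro i A (⟨V, hV, rfl⟩ | ⟨hA, hfA⟩) B (⟨V', hV', rfl⟩ | ⟨hB, hfB⟩) hne x hx y hy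
    · obtain ⟨v, hv, h1⟩ := hN i V x hx
      obtain ⟨w, hw, h2⟩ := hN i V' y hy
      have h3 := hVdisj i V hV V' hV' (fun h => hne (by rw [h])) v hv w hw
      have h4 := dist_triangle v x w
      have h5 := dist_triangle x y w
      rw [dist_comm v x] at h4
      linarith
    · exact hmix i V B hB (hfB V hV) x hx y hy
    · rw [dist_comm]
      exact hmix i V' A hA (hfA V' hV') y hy x hx
    · exact hWdisj i A hA B hB hne x hx y hy
  · rintro i A (⟨V, hV, rfl⟩ | ⟨hA, -⟩) x hx y hy
    · refine le_trans ?_ (le_max_right _ _)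
      obtain ⟨v, hv, h1⟩ := hN i V x hx
      obtain ⟨w, hw, h2⟩ := hN i V y hy
      have h3 := hVbd i V hV v hv w hw
      have h4 := dist_triangle x v y
      have h5 := dist_triangle v w y
      rw [dist_comm w y] at h5
      linarith
    · exact (hWbd i A hA x hx y hy).trans (le_max_left _ _)
end

section
/- If a metric space is presented as a union A ∪ B of two subspaces, then asdim (A ∪ B) ≤ max{asdim A, asdim B}. -/
theorem asdimOnLE_mono {X : Type*} (dist : X → X → ℝ) (A : Set X) {m k : ℕ} (h : m ≤ k)
    (hA : AsdimOnLE dist A m) : AsdimOnLE dist A k := by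
  intro d hd
  obtain ⟨R, 𝒰, h1, h2, h3, h4⟩ := hA d hd
  refine ⟨R, fun i => {U | ∃ j : Fin (m + 1), j.val = i.val ∧ U ∈ 𝒰 j}, ?_, ?_, ?_, ?_⟩
  · rintro i U ⟨j, -, hU⟩
    exact h1 j U hU
  · intro x hx
    obtain ⟨i, U, hU, hxU⟩ := h2 x hx
    exact ⟨⟨i.val, by omega⟩, U, ⟨i, rfl, hU⟩, hxU⟩
  · rintro i U ⟨j, hj, hU⟩ V ⟨j2, hj2, hV⟩
    obtain rfl : j = j2 := Fin.ext (hj.trans hj2.symm)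
    exact h3 j U hU V hV
  · rintro i U ⟨j, -, hU⟩
    exact h4 j U hU

/-- **Finite Union Theorem.** If a metric space is presented as a union `A ∪ B` of two
subspaces then `asdim (A ∪ B) ≤ max (asdim A) (asdim B)`. -/
theorem finite_union_theorem {X : Type*} [MetricSpace X] (A B : Set X) (m n : ℕ)
    (hA : AsdimOnLE dist A m) (hB : AsdimOnLE dist B n) :
    AsdimOnLE dist (A ∪ B) (max m n) := by
  replace hA := asdimOnLE_mono dist A (le_max_left m n) hA
  replace hB := asdimOnLE_mono dist B (le_max_right m n) hB
  intro d hd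
  obtain ⟨R₀, 𝒰, a1, a2, a3, a4₀⟩ := hA d hd
  obtain ⟨R, hR, a4⟩ : ∃ R : ℝ, 0 ≤ R ∧ ∀ i, ∀ U ∈ 𝒰 i, ∀ x ∈ U, ∀ y ∈ U, dist x y ≤ R :=
    ⟨max R₀ 0, le_max_right _ _, fun i U hU x hx y hy =>
      (a4₀ i U hU x hx y hy).trans (le_max_left _ _)⟩
  obtain ⟨S, 𝒱, b1, b2, b3, b4⟩ := hB (3 * d + 2 * R) (by positivity)
  let near : Set X → Set X → Prop := fun U V => ∃ u ∈ U, ∃ v ∈ V, dist u v < d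
  let sat : Fin (max m n + 1) → Set X → Set X :=
    fun i V => V ∪ {x | ∃ U ∈ 𝒰 i, near U V ∧ x ∈ U}
  have hsat : ∀ i V, ∀ x ∈ sat i V, ∃ v ∈ V, dist x v ≤ d + R := by
    rintro i V x (hx | ⟨U, hU, ⟨u, hu, v, hv, huv⟩, hx⟩)
    · exact ⟨x, hx, by rw [dist_self]; positivity⟩
    · refine ⟨v, hv, ?_⟩
      have := a4 i U hU x hx u hu
      linarith [dist_triangle x u v]
  have hmix : ∀ i, ∀ V ∈ 𝒱 i, ∀ U ∈ 𝒰 i, (∀ V ∈ 𝒱 i, ¬ near U V) →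
      ∀ x ∈ sat i V, ∀ y ∈ U, d ≤ dist x y := by
    rintro i V hV U hU hn x (hx | ⟨U2, hU2, hnear, hx⟩) y hy
    · by_contra! hlt
      exact hn V hV ⟨y, hy, x, hx, by rwa [dist_comm]⟩
    · refine a3 i U2 hU2 U hU ?_ x hx y hy
      rintro rfl
      exact hn V hV hnear
  refine ⟨max R (2 * (d + R) + S), fun i => {W | (∃ V ∈ 𝒱 i, W = sat i V) ∨
    (W ∈ 𝒰 i ∧ ∀ V ∈ 𝒱 i, ¬ near W V)}, ?_, ?_, ?_, ?_⟩
  · rintro i W (⟨V, hV, rfl⟩ | ⟨hW, -⟩)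
    · rintro x (hx | ⟨U, hU, -, hx⟩)
      · exact Or.inr (b1 i V hV hx)
      · exact Or.inl (a1 i U hU hx)
    · exact fun x hx => Or.inl (a1 i W hW hx)
  · rintro x (hx | hx)
    · obtain ⟨i, U, hU, hxU⟩ := a2 x hx
      by_cases hn : ∀ V ∈ 𝒱 i, ¬ near U V
      · exact ⟨i, U, Or.inr ⟨hU, hn⟩, hxU⟩
      · push Not at hn
        obtain ⟨V, hV, hUV⟩ := hn
        exact ⟨i, sat i V, Or.inl ⟨V, hV, rfl⟩, Or.inr ⟨U, hU, hUV, hxU⟩⟩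
    · obtain ⟨i, V, hV, hxV⟩ := b2 x hx
      exact ⟨i, sat i V, Or.inl ⟨V, hV, rfl⟩, Or.inl hxV⟩
  · rintro i W (⟨V, hV, rfl⟩ | ⟨hW, hWn⟩) W2 (⟨V2, hV2, rfl⟩ | ⟨hW2, hWn2⟩) hne x hx y hy
    · obtain ⟨v, hv, hxv⟩ := hsat i V x hx
      obtain ⟨w, hw, hyw⟩ := hsat i V2 y hy
      have h := b3 i V hV V2 hV2 (fun h => hne (by rw [h])) v hv w hw
      have h1 := dist_triangle4 v x y w
      rw [dist_comm v x] at h1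
      linarith
    · exact hmix i V hV W2 hW2 hWn2 x hx y hy
    · rw [dist_comm]
      exact hmix i V2 hV2 W hW hWn y hy x hx
    · exact a3 i W hW W2 hW2 hne x hx y hy
  · rintro i W (⟨V, hV, rfl⟩ | ⟨hW, -⟩) x hx y hy
    · refine le_trans ?_ (le_max_right _ _)
      obtain ⟨v, hv, hxv⟩ := hsat i V x hx
      obtain ⟨w, hw, hyw⟩ := hsat i V y hy
      have h := b4 i V hV v hv w hw
      have h1 := dist_triangle4 x v w y
      rw [dist_comm w y] at h1
      linarith
    · exact (a4 i W hW x hx y hy).trans (le_max_left _ _)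
end

section
/- Assume a finitely generated group Γ, equipped with a word metric, acts by isometries on a metric space X with base point x₀, where asdim X ≤ k. Suppose that asdim W_R(x₀) ≤ n for all R > 0, where the R-stabilizer W_R(x₀) = {g ∈ Γ : dist(g·x₀, x₀) ≤ R} carries the metric induced from Γ. Then asdim Γ ≤ (n+1)(k+1) − 1. -/
/-- The word norm of `x` with respect to the alphabet `S ∪ S⁻¹` : the minimal length of
a word in `S ∪ S⁻¹` representing `x`. -/
noncomputable def wordNorm {G : Type*} [Group G] (S : Set G) (x : G) : ℕ :=
  sInf {n : ℕ | ∃ l : List G, l.length = n ∧ (∀ g ∈ l, g ∈ S ∨ g⁻¹ ∈ S) ∧ l.prod = x}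

/-- The left-invariant word metric `d_S(x,y) = ‖x⁻¹y‖_S`. -/
noncomputable def wordDist {G : Type*} [Group G] (S : Set G) (x y : G) : ℝ :=
  (wordNorm S (x⁻¹ * y) : ℝ)

theorem asdimAux_norm {Γ : Type*} [Group Γ] {X : Type*} [MetricSpace X]
    [MulAction Γ X] (hiso : ∀ g : Γ, Isometry fun x : X => g • x)
    (S : Finset Γ) (hS : Subgroup.closure (S : Set Γ) = ⊤) (x₀ : X) :
    ∃ c : ℝ, 0 ≤ c ∧ ∀ g h : Γ, dist (g • x₀) (h • x₀) ≤ c * wordDist (S : Set Γ) g h := by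
  have hd : ∀ g x y, dist (g • x : X) (g • y) = dist x y := fun g x y => (hiso g).dist_eq x y
  have hinv : ∀ g : Γ, dist (g⁻¹ • x₀) x₀ = dist (g • x₀) x₀ := by
    intro g
    rw [← hd g (g⁻¹ • x₀) x₀, smul_inv_smul, dist_comm]
  refine ⟨∑ s ∈ S, dist (s • x₀) x₀, Finset.sum_nonneg fun _ _ => dist_nonneg, ?_⟩
  set c := ∑ s ∈ S, dist (s • x₀) x₀ with hc
  have hs : ∀ s ∈ S, dist (s • x₀) x₀ ≤ c := fun s hs =>
    Finset.single_le_sum (f := fun s : Γ => dist (s • x₀) x₀) (fun _ _ => dist_nonneg) hs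
  have hl : ∀ l : List Γ, (∀ g ∈ l, g ∈ (S : Set Γ) ∨ g⁻¹ ∈ (S : Set Γ)) →
      dist (l.prod • x₀) x₀ ≤ c * l.length := by
    intro l
    induction l with
    | nil => intro _; simp
    | cons a l ih =>
      intro h
      have h1 := ih fun g hg => h g (List.mem_cons_of_mem _ hg)
      have h2 : dist (a • x₀) x₀ ≤ c := by
        rcases h a List.mem_cons_self with h | h
        · exact hs a h
        · rw [← hinv]; exact hs _ h
      have h3 := dist_triangle ((a * l.prod) • x₀) (a • x₀) x₀
      rw [mul_smul, hd, ← mul_smul] at h3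
      rw [List.prod_cons, List.length_cons]
      push_cast
      linarith
  intro g h
  have hne : {n : ℕ | ∃ l : List Γ, l.length = n ∧
      (∀ g ∈ l, g ∈ (S : Set Γ) ∨ g⁻¹ ∈ (S : Set Γ)) ∧ l.prod = g⁻¹ * h}.Nonempty := by
    have : g⁻¹ * h ∈ Subgroup.closure (S : Set Γ) := by rw [hS]; trivial
    rw [← Subgroup.mem_toSubmonoid, Subgroup.closure_toSubmonoid] at this
    obtain ⟨l, h1, h2⟩ := Submonoid.exists_list_of_mem_closure this
    exact ⟨_, l, rfl, fun y hy => h1 y hy, h2⟩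
  obtain ⟨l, h1, h2, h3⟩ := Nat.sInf_mem hne
  have h4 := hl l h2
  rw [h3, h1] at h4
  rw [dist_comm, ← hd g⁻¹, ← mul_smul, ← mul_smul, inv_mul_cancel, one_smul]
  exact h4

/-- **Theorem 2.** Suppose a finitely generated group `Γ` (with the word metric from a
finite generating set `S`) acts by isometries on a metric space `X` with base point `x₀`
and `asdim X ≤ k`.  If every `R`-stabilizer `W_R(x₀) = {g : dist (g • x₀) x₀ ≤ R}`
(with the metric induced from `Γ`) has `asdim ≤ n`, then `asdim Γ ≤ (n+1)(k+1) - 1`. -/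
theorem asdim_le_of_action {Γ : Type*} [Group Γ] {X : Type*} [MetricSpace X]
    [MulAction Γ X] (hiso : ∀ g : Γ, Isometry fun x : X => g • x)
    (S : Finset Γ) (hS : Subgroup.closure (S : Set Γ) = ⊤)
    (x₀ : X) (k n : ℕ)
    (hX : AsdimOnLE dist (Set.univ : Set X) k)
    (hW : ∀ R : ℝ, 0 < R →
      AsdimOnLE (wordDist (S : Set Γ)) {g : Γ | dist (g • x₀) x₀ ≤ R} n) :
    AsdimOnLE (wordDist (S : Set Γ)) (Set.univ : Set Γ) ((n + 1) * (k + 1) - 1) := by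
  obtain ⟨c, hc0, hc⟩ := asdimAux_norm hiso S hS x₀
  intro d hd
  obtain ⟨R, 𝒱, -, hVc, hVd, hVb⟩ := hX (c * d + 1) (by positivity)
  obtain ⟨B, 𝒰, -, hUc, hUd, hUb⟩ := hW (max R 1) (by positivity) d hd
  have hch : ∀ V : Set X, ∃ a : Γ, (∃ g : Γ, g • x₀ ∈ V) → a • x₀ ∈ V := by
    intro V
    by_cases h : ∃ g : Γ, g • x₀ ∈ V
    · obtain ⟨g, hg⟩ := h
      exact ⟨g, fun _ => hg⟩
    · exact ⟨1, fun h' => absurd h' h⟩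
  choose a ha using hch
  have hwd : ∀ a g h : Γ, wordDist (S : Set Γ) (a⁻¹ * g) (a⁻¹ * h) = wordDist (S : Set Γ) g h := by
    intro a g h
    unfold wordDist
    congr 2
    group
  have hcard : (n + 1) * (k + 1) - 1 + 1 = (n + 1) * (k + 1) :=
    Nat.sub_add_cancel (Nat.succ_le_of_lt (by positivity))
  let e : Fin ((n + 1) * (k + 1) - 1 + 1) ≃ Fin (n + 1) × Fin (k + 1) :=
    (finCongr hcard).trans finProdFinEquiv.symm
  refine ⟨B, fun m => {A | ∃ V ∈ 𝒱 (e m).2, ∃ U ∈ 𝒰 (e m).1,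
    A = {g : Γ | g • x₀ ∈ V ∧ (a V)⁻¹ * g ∈ U}}, ?_, ?_, ?_, ?_⟩
  · intro _ _ _; exact Set.subset_univ _
  · intro g _
    obtain ⟨i, V, hV, hgV⟩ := hVc (g • x₀) trivial
    have h1 := hVb i V hV _ hgV _ (ha V ⟨g, hgV⟩)
    have h2 : dist (((a V)⁻¹ * g) • x₀) x₀ ≤ max R 1 := by
      refine le_trans ?_ (le_max_left R 1)
      have h3 := (hiso (a V)).dist_eq (((a V)⁻¹ * g) • x₀) x₀
      simp only [← mul_smul, mul_inv_cancel_left] at h3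
      rw [← h3]; exact h1
    obtain ⟨j, U, hU, hgU⟩ := hUc _ h2
    refine ⟨e.symm (j, i), _, ⟨V, ?_, U, ?_, rfl⟩, hgV, hgU⟩
    · simpa using hV
    · simpa using hU
  · rintro m _ ⟨V, hV, U, hU, rfl⟩ _ ⟨V', hV', U', hU', rfl⟩ hne g ⟨hgV, hgU⟩ h ⟨hhV, hhU⟩
    by_cases hVV : V = V'
    · subst hVV
      have hUU : U ≠ U' := by
        rintro rfl; exact hne rfl
      rw [← hwd (a V)]
      exact hUd _ U hU U' hU' hUU _ hgU _ hhU
    · have h1 := hVd _ V hV V' hV' hVV _ hgV _ hhV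
      by_contra hlt
      have h2 := mul_le_mul_of_nonneg_left (not_le.mp hlt).le hc0
      linarith [hc g h]
  · rintro m _ ⟨V, hV, U, hU, rfl⟩ g ⟨_, hgU⟩ h ⟨_, hhU⟩
    rw [← hwd (a V)]
    exact hUb _ U hU _ hgU _ hhU
end

section
/- Let φ : G → H be an epimorphism of a finitely generated group G onto a group H, with kernel K = ker φ. Equip G with a word metric d_S for a finite generating set S, equip K ⊆ G with the induced metric, and equip H with the word metric for the finite generating set φ(S). If asdim K ≤ k and asdim H ≤ n, then asdim G ≤ (n+1)(k+1) − 1. -/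
theorem wordNorm_le_length {G : Type*} [Group G] (S : Set G) (l : List G)
    (hl : ∀ g ∈ l, g ∈ S ∨ g⁻¹ ∈ S) : wordNorm S l.prod ≤ l.length :=
  Nat.sInf_le ⟨l, rfl, hl, rfl⟩

theorem exists_word {G : Type*} [Group G] (S : Set G) (hS : Subgroup.closure S = ⊤) (x : G) :
    ∃ l : List G, l.length = wordNorm S x ∧ (∀ g ∈ l, g ∈ S ∨ g⁻¹ ∈ S) ∧ l.prod = x := by
  have hne : {n : ℕ | ∃ l : List G, l.length = n ∧ (∀ g ∈ l, g ∈ S ∨ g⁻¹ ∈ S) ∧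
      l.prod = x}.Nonempty := by
    have hx : x ∈ Submonoid.closure (S ∪ S⁻¹) := by
      rw [← Subgroup.closure_toSubmonoid, hS]; trivial
    obtain ⟨l, hl, hx⟩ := Submonoid.exists_list_of_mem_closure hx
    exact ⟨l.length, l, rfl, hl, hx⟩
  exact Nat.sInf_mem hne

theorem wordNorm_mul_le {G : Type*} [Group G] (S : Set G) (hS : Subgroup.closure S = ⊤)
    (x y : G) : wordNorm S (x * y) ≤ wordNorm S x + wordNorm S y := by
  obtain ⟨l, h1, h2, h3⟩ := exists_word S hS x
  obtain ⟨m, k1, k2, k3⟩ := exists_word S hS y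
  have := wordNorm_le_length S (l ++ m) (by
    intro g hg
    rcases List.mem_append.1 hg with h | h
    · exact h2 g h
    · exact k2 g h)
  simpa [h1, h3, k1, k3] using this

theorem wordNorm_inv_le {G : Type*} [Group G] (S : Set G) (hS : Subgroup.closure S = ⊤)
    (x : G) : wordNorm S x⁻¹ ≤ wordNorm S x := by
  obtain ⟨l, h1, h2, h3⟩ := exists_word S hS x
  have := wordNorm_le_length S (l.map (fun g => g⁻¹)).reverse (by
    intro g hg
    simp only [List.mem_reverse, List.mem_map] at hg
    obtain ⟨a, ha, rfl⟩ := hg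
    rw [inv_inv]
    exact (h2 a ha).symm)
  rw [← List.prod_inv_reverse, h3] at this
  simpa [h1] using this

theorem wordDist_triangle {G : Type*} [Group G] (S : Set G) (hS : Subgroup.closure S = ⊤)
    (x y z : G) : wordDist S x z ≤ wordDist S x y + wordDist S y z := by
  have := wordNorm_mul_le S hS (x⁻¹ * y) (y⁻¹ * z)
  rw [show x⁻¹ * y * (y⁻¹ * z) = x⁻¹ * z by group] at this
  unfold wordDist
  exact_mod_cast this

theorem wordDist_symm_le {G : Type*} [Group G] (S : Set G) (hS : Subgroup.closure S = ⊤)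
    (x y : G) : wordDist S x y ≤ wordDist S y x := by
  have := wordNorm_inv_le S hS (y⁻¹ * x)
  rw [show (y⁻¹ * x)⁻¹ = x⁻¹ * y by group] at this
  unfold wordDist
  exact_mod_cast this

theorem wordDist_left {G : Type*} [Group G] (S : Set G) (a x y : G) :
    wordDist S (a * x) (a * y) = wordDist S x y := by
  unfold wordDist
  rw [show (a * x)⁻¹ * (a * y) = x⁻¹ * y by group]

theorem wordDist_map_le {G H : Type*} [Group G] [Group H] (φ : G →* H) (S : Set G)
    (hS : Subgroup.closure S = ⊤) (x y : G) :
    wordDist (φ '' S) (φ x) (φ y) ≤ wordDist S x y := by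
  obtain ⟨l, h1, h2, h3⟩ := exists_word S hS (x⁻¹ * y)
  have := wordNorm_le_length (φ '' S) (l.map φ) (by
    intro g hg
    obtain ⟨a, ha, rfl⟩ := List.mem_map.1 hg
    rcases h2 a ha with h | h
    · exact Or.inl ⟨a, h, rfl⟩
    · exact Or.inr ⟨a⁻¹, h, by simp⟩)
  rw [← map_list_prod, h3, List.length_map, h1] at this
  unfold wordDist
  rw [← map_inv, ← map_mul]
  exact_mod_cast this

theorem exists_list_lift {G H : Type*} [Group G] [Group H] (φ : G →* H) (S : Set G)
    (l : List H) (hl : ∀ g ∈ l, g ∈ φ '' S ∨ g⁻¹ ∈ φ '' S) :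
    ∃ m : List G, m.length = l.length ∧ (∀ g ∈ m, g ∈ S ∨ g⁻¹ ∈ S) ∧ φ m.prod = l.prod := by
  induction l with
  | nil => exact ⟨[], by simp⟩
  | cons a t ih =>
    obtain ⟨m, h1, h2, h3⟩ := ih (fun g hg => hl g (List.mem_cons_of_mem _ hg))
    obtain ⟨b, hb, hba⟩ : ∃ b : G, (b ∈ S ∨ b⁻¹ ∈ S) ∧ φ b = a := by
      rcases hl a List.mem_cons_self with ⟨b, hb, h⟩ | ⟨b, hb, h⟩
      · exact ⟨b, Or.inl hb, h⟩
      · exact ⟨b⁻¹, Or.inr (by simpa using hb), by simp [h]⟩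
    refine ⟨b :: m, by simp [h1], ?_, by simp [h3, hba]⟩
    intro g hg
    rcases List.mem_cons.1 hg with rfl | h
    · exact hb
    · exact h2 g h

theorem exists_lift {G H : Type*} [Group G] [Group H] (φ : G →* H)
    (hφ : Function.Surjective φ) (S : Set G) (hS : Subgroup.closure S = ⊤) (h : H) :
    ∃ s : G, φ s = h ∧ wordNorm S s ≤ wordNorm (φ '' S) h := by
  have hS' : Subgroup.closure (φ '' S) = ⊤ := by
    rw [← MonoidHom.map_closure, hS, Subgroup.map_top_of_surjective φ hφ]
  obtain ⟨l, h1, h2, h3⟩ := exists_word (φ '' S) hS' h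
  obtain ⟨m, k1, k2, k3⟩ := exists_list_lift φ S l h2
  refine ⟨m.prod, k3.trans h3, ?_⟩
  have := wordNorm_le_length S m k2
  omega

/-- **Theorem 3.** Let `φ : G → H` be an epimorphism of a finitely generated group `G`
(with word metric from a finite generating set `S`) onto `H` (with word metric from
`φ(S)`), with kernel `K` (with the induced metric).  If `asdim K ≤ k` and `asdim H ≤ n`
then `asdim G ≤ (n+1)(k+1) - 1`. -/
theorem asdim_le_of_extension {G H : Type*} [Group G] [Group H]
    (φ : G →* H) (hφ : Function.Surjective φ)
    (S : Finset G) (hS : Subgroup.closure (S : Set G) = ⊤)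
    (k n : ℕ)
    (hK : AsdimOnLE (wordDist (S : Set G)) (φ.ker : Set G) k)
    (hH : AsdimOnLE (wordDist (φ '' (S : Set G))) (Set.univ : Set H) n) :
    AsdimOnLE (wordDist (S : Set G)) (Set.univ : Set G) ((n + 1) * (k + 1) - 1) := by
  intro d hd
  obtain ⟨R, 𝒱, -, hVc, hVd, hVb⟩ := hH d hd
  obtain ⟨D, 𝒲, -, hWc, hWd, hWb⟩ := hK (d + 2 * max R 0) (by positivity)
  have hc : ∀ V : Set H, ∃ g : G, V.Nonempty → φ g ∈ V := by
    intro V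
    by_cases hV : V.Nonempty
    · obtain ⟨h, hh⟩ := hV
      obtain ⟨g, rfl⟩ := hφ h
      exact ⟨g, fun _ => hh⟩
    · exact ⟨1, fun h => absurd h hV⟩
  choose c hc using hc
  have hcard : (n + 1) * (k + 1) - 1 + 1 = (n + 1) * (k + 1) :=
    Nat.sub_add_cancel (Nat.mul_pos (Nat.succ_pos n) (Nat.succ_pos k))
  let e : Fin ((n + 1) * (k + 1) - 1 + 1) ≃ Fin (n + 1) × Fin (k + 1) :=
    (finCongr hcard).trans finProdFinEquiv.symm
  let P : Set H → Set G → Set G := fun V W =>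
    {g | φ g ∈ V ∧ ∃ κ ∈ W, wordDist (S : Set G) (c V * κ) g ≤ max R 0}
  refine ⟨D + 2 * max R 0, fun i => {U | ∃ V ∈ 𝒱 (e i).1, ∃ W ∈ 𝒲 (e i).2, U = P V W},
    fun _ _ _ => Set.subset_univ _, ?_, ?_, ?_⟩
  · intro g _
    obtain ⟨j, V, hV, hgV⟩ := hVc (φ g) trivial
    have hcV := hc V ⟨_, hgV⟩
    have hb := hVb j V hV _ hgV _ hcV
    obtain ⟨s, hs, hsn⟩ := exists_lift φ hφ (S : Set G) hS ((φ g)⁻¹ * φ (c V))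
    have hκ : (c V)⁻¹ * (g * s) ∈ (φ.ker : Set G) := by
      simp [MonoidHom.mem_ker, hs]
    obtain ⟨i, W, hW, hκW⟩ := hWc _ hκ
    refine ⟨e.symm (j, i), P V W, ⟨V, by simpa using hV, W, by simpa using hW, rfl⟩, hgV, _,
      hκW, ?_⟩
    refine (wordDist_symm_le _ hS _ _).trans (le_trans ?_ (le_max_left R 0))
    refine le_trans ?_ hb
    unfold wordDist
    rw [show g⁻¹ * (c V * ((c V)⁻¹ * (g * s))) = s by group]
    exact_mod_cast hsn
  · rintro i _ ⟨V, hV, W, hW, rfl⟩ _ ⟨V', hV', W', hW', rfl⟩ hne x ⟨hxV, a, ha, hax⟩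
      y ⟨hyV, b, hb, hby⟩
    by_cases hVV : V = V'
    · subst hVV
      have hWW : W ≠ W' := by
        rintro rfl
        exact hne rfl
      have h1 := hWd _ W hW W' hW' hWW a ha b hb
      rw [← wordDist_left _ (c V)] at h1
      have h2 := wordDist_triangle _ hS (c V * a) x (c V * b)
      have h3 := wordDist_triangle _ hS x y (c V * b)
      have h4 := wordDist_symm_le _ hS y (c V * b)
      linarith
    · exact (hVd _ V hV V' hV' hVV _ hxV _ hyV).trans (wordDist_map_le φ _ hS x y)
  · rintro i _ ⟨V, hV, W, hW, rfl⟩ x ⟨hxV, a, ha, hax⟩ y ⟨hyV, b, hb, hby⟩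
    have h1 := hWb _ W hW a ha b hb
    rw [← wordDist_left _ (c V)] at h1
    have h2 := wordDist_triangle _ hS x (c V * a) y
    have h3 := wordDist_triangle _ hS (c V * a) (c V * b) y
    have h4 := wordDist_symm_le _ hS x (c V * a)
    linarith
end

section
/- Let A_1, …, A_k be finitely generated groups with asdim A_i ≤ n for each i. Then the free product satisfies asdim (A_1 ∗ ⋯ ∗ A_k) ≤ 2n + 1. -/
namespace FPAsdim

open Monoid

/-- `x` is a product of exactly `n` letters of `S ∪ S⁻¹`. -/
def Rep {G : Type*} [Group G] (S : Set G) (x : G) (n : ℕ) : Prop :=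
  ∃ l : List G, l.length = n ∧ (∀ g ∈ l, g ∈ S ∨ g⁻¹ ∈ S) ∧ l.prod = x

section Rep
variable {G : Type*} [Group G] {S : Set G}

lemma Rep.norm_le {x : G} {n : ℕ} (h : Rep S x n) : wordNorm S x ≤ n := Nat.sInf_le h

lemma Rep.norm {x : G} {n : ℕ} (h : Rep S x n) : Rep S x (wordNorm S x) :=
  Nat.sInf_mem (s := {n : ℕ | Rep S x n}) ⟨n, h⟩

lemma Rep.one : Rep S (1 : G) 0 := ⟨[], rfl, by simp, rfl⟩

lemma Rep.gen {s : G} (h : s ∈ S ∨ s⁻¹ ∈ S) : Rep S s 1 := ⟨[s], rfl, by simpa using h, by simp⟩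

lemma Rep.mul {x y : G} {m n : ℕ} (hx : Rep S x m) (hy : Rep S y n) : Rep S (x * y) (m + n) := by
  obtain ⟨l, rfl, h1, rfl⟩ := hx
  obtain ⟨l', rfl, h2, rfl⟩ := hy
  refine ⟨l ++ l', by simp, ?_, by simp⟩
  intro g hg
  rcases List.mem_append.1 hg with h | h
  exacts [h1 g h, h2 g h]

lemma Rep.inv {x : G} {m : ℕ} (hx : Rep S x m) : Rep S x⁻¹ m := by
  obtain ⟨l, rfl, h1, rfl⟩ := hx
  refine ⟨(l.map fun g => g⁻¹).reverse, by simp, ?_, (List.prod_inv_reverse l).symm⟩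
  intro g hg
  simp only [List.mem_reverse, List.mem_map] at hg
  obtain ⟨a, ha, rfl⟩ := hg
  have := h1 a ha
  rw [inv_inv]
  exact this.symm

lemma exists_rep (hS : Subgroup.closure S = ⊤) (x : G) : ∃ n, Rep S x n := by
  have hx : x ∈ Subgroup.closure S := hS ▸ Subgroup.mem_top x
  induction hx using Subgroup.closure_induction with
  | mem x h => exact ⟨1, Rep.gen (Or.inl h)⟩
  | one => exact ⟨0, Rep.one⟩
  | mul x y _ _ hx hy =>
    obtain ⟨m, hm⟩ := hx
    obtain ⟨n, hn⟩ := hy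
    exact ⟨_, hm.mul hn⟩
  | inv x _ hx =>
    obtain ⟨m, hm⟩ := hx
    exact ⟨_, hm.inv⟩

lemma rep_norm (hS : Subgroup.closure S = ⊤) (x : G) : Rep S x (wordNorm S x) :=
  (exists_rep hS x).choose_spec.norm

lemma norm_one : wordNorm S (1 : G) = 0 := Nat.le_zero.1 Rep.one.norm_le

lemma norm_mul_le (hS : Subgroup.closure S = ⊤) (x y : G) :
    wordNorm S (x * y) ≤ wordNorm S x + wordNorm S y :=
  ((rep_norm hS x).mul (rep_norm hS y)).norm_le

lemma norm_inv_le (hS : Subgroup.closure S = ⊤) (x : G) : wordNorm S x⁻¹ ≤ wordNorm S x :=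
  (rep_norm hS x).inv.norm_le

lemma norm_gen {s : G} (h : s ∈ S ∨ s⁻¹ ∈ S) : wordNorm S s ≤ 1 := (Rep.gen h).norm_le

end Rep

section Words
variable {ι : Type*} {A : ι → Type*} [∀ i, Group (A i)]

/-- The list of syllables of the reduced word representing `g`. -/
noncomputable def toW (g : CoprodI A) : List (Σ i, A i) := by
  classical exact (CoprodI.Word.equiv g).toList

/-- The product of a list of syllables. -/
def lprod (L : List (Σ i, A i)) : CoprodI A := (L.map fun l => CoprodI.of l.snd).prod

lemma lprod_append (L L' : List (Σ i, A i)) : lprod (L ++ L') = lprod L * lprod L' := by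
  simp [lprod]

lemma lprod_cons (x : Σ i, A i) (L : List (Σ i, A i)) :
    lprod (x :: L) = CoprodI.of x.2 * lprod L := by
  simp [lprod]

lemma lprod_toW (g : CoprodI A) : lprod (toW g) = g := by
  classical
  exact CoprodI.Word.equiv.left_inv g

/-- reduced lists -/
def Red (L : List (Σ i, A i)) : Prop :=
  (∀ l ∈ L, l.2 ≠ 1) ∧ L.IsChain fun l l' => l.1 ≠ l'.1

lemma red_toW (g : CoprodI A) : Red (toW g) := by
  classical
  exact ⟨(CoprodI.Word.equiv g).ne_one, (CoprodI.Word.equiv g).chain_ne⟩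

lemma toW_lprod {L : List (Σ i, A i)} (h : Red L) : toW (lprod L) = L := by
  classical
  exact congrArg CoprodI.Word.toList
    (CoprodI.Word.equiv.right_inv (⟨L, h.1, h.2⟩ : CoprodI.Word A))

open Classical in
/-- append a possibly trivial syllable -/
noncomputable def app (l : List (Σ i, A i)) (i : ι) (a : A i) : List (Σ i, A i) :=
  if a = 1 then l else l ++ [⟨i, a⟩]

lemma app_one (l : List (Σ i, A i)) (i : ι) : app l i 1 = l := by simp [app]

lemma app_ne (l : List (Σ i, A i)) (i : ι) {a : A i} (h : a ≠ 1) : app l i a = l ++ [⟨i, a⟩] := by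
  simp [app, h]

lemma lprod_app (l : List (Σ i, A i)) (i : ι) (a : A i) :
    lprod (app l i a) = lprod l * CoprodI.of a := by
  by_cases h : a = 1
  · subst h; simp [app_one]
  · rw [app_ne _ _ h, lprod_append]; simp [lprod]

lemma red_app {l : List (Σ i, A i)} {i : ι} (hl : Red l) (hi : ∀ x ∈ l.getLast?, x.1 ≠ i)
    (a : A i) : Red (app l i a) := by
  by_cases h : a = 1
  · subst h; simpa [app_one]
  · rw [app_ne _ _ h]
    refine ⟨?_, ?_⟩
    · intro x hx
      rcases List.mem_append.1 hx with hx | hx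
      · exact hl.1 x hx
      · simp only [List.mem_singleton] at hx
        subst hx; exact h
    · rw [List.isChain_append]
      refine ⟨hl.2, by simp, ?_⟩
      intro x hx y hy
      simp only [List.head?_cons, Option.mem_def, Option.some.injEq] at hy
      subst hy
      exact hi x hx

lemma toW_step (g : CoprodI A) (i : ι) (s : A i) :
    ∃ l a, toW g = app l i a ∧ toW (g * CoprodI.of s) = app l i (a * s) := by
  have key : ∃ l a, toW g = app l i a ∧ Red l ∧ (∀ x ∈ l.getLast?, x.1 ≠ i) := by
    have hr := red_toW g
    rcases List.eq_nil_or_concat (toW g) with h | ⟨l, ⟨j, b⟩, h⟩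
    · exact ⟨[], 1, by rw [app_one, h], ⟨by simp, by simp⟩, by simp⟩
    · rw [List.concat_eq_append] at h
      rw [h] at hr
      by_cases hj : j = i
      · subst hj
        have hb : b ≠ 1 := hr.1 ⟨j, b⟩ (by simp)
        obtain ⟨h1, h2⟩ := hr
        rw [List.isChain_append] at h2
        refine ⟨l, b, by rw [h, app_ne _ _ hb], ⟨fun x hx => h1 x (by simp [hx]), h2.1⟩, ?_⟩
        intro x hx
        exact h2.2.2 x hx ⟨j, b⟩ (by simp)
      · refine ⟨l ++ [⟨j, b⟩], 1, by rw [h, app_one], hr, ?_⟩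
        intro x hx
        simp at hx
        subst hx
        exact hj
  obtain ⟨l, a, h1, h2, h3⟩ := key
  refine ⟨l, a, h1, ?_⟩
  rw [← toW_lprod (red_app h2 h3 (a * s)), lprod_app, map_mul, ← mul_assoc, ← lprod_app, ← h1,
    lprod_toW]

variable (S : ∀ i, Set (A i))

/-- total length of a list of syllables -/
noncomputable def len (L : List (Σ i, A i)) : ℕ := (L.map fun x => wordNorm (S x.1) x.2).sum

@[simp] lemma len_nil : len S [] = 0 := rfl

@[simp] lemma len_cons (x : Σ i, A i) (L) : len S (x :: L) = wordNorm (S x.1) x.2 + len S L := by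
  simp [len]

@[simp] lemma len_append (L L' : List (Σ i, A i)) : len S (L ++ L') = len S L + len S L' := by
  simp [len]

lemma len_app (l : List (Σ i, A i)) (i : ι) (a : A i) :
    len S (app l i a) = len S l + wordNorm (S i) a := by
  by_cases h : a = 1
  · subst h; simp [app_one, norm_one]
  · simp [app_ne _ _ h]

/-- generating set of the free product -/
def gens : Set (CoprodI A) := ⋃ i, (CoprodI.of (M := A)) '' (S i)

lemma gens_iff {t : CoprodI A} (h : t ∈ gens S ∨ t⁻¹ ∈ gens S) :
    ∃ i, ∃ s : A i, (s ∈ S i ∨ s⁻¹ ∈ S i) ∧ t = CoprodI.of s := by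
  rcases h with h | h
  · obtain ⟨i, s, hs, rfl⟩ := Set.mem_iUnion.1 h
    exact ⟨i, s, Or.inl hs, rfl⟩
  · obtain ⟨i, s, hs, hs'⟩ := Set.mem_iUnion.1 h
    exact ⟨i, s⁻¹, Or.inr (by simpa using hs), by rw [map_inv, hs', inv_inv]⟩

lemma Rep.of {i : ι} {a : A i} {n : ℕ} (h : Rep (S i) a n) :
    Rep (gens S) (CoprodI.of a : CoprodI A) n := by
  obtain ⟨l, rfl, h1, rfl⟩ := h
  refine ⟨l.map CoprodI.of, by simp, ?_, by simp [map_list_prod]⟩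
  intro g hg
  obtain ⟨x, hx, rfl⟩ := List.mem_map.1 hg
  rcases h1 x hx with h | h
  · exact Or.inl (Set.mem_iUnion.2 ⟨i, x, h, rfl⟩)
  · exact Or.inr (Set.mem_iUnion.2 ⟨i, x⁻¹, h, by simp⟩)

variable {S}

lemma rep_lprod (hS : ∀ i, Subgroup.closure (S i) = ⊤)
    (L : List (Σ i, A i)) : Rep (gens S) (lprod L) (len S L) := by
  induction L with
  | nil => exact Rep.one
  | cons x L ih =>
    rw [lprod_cons, len_cons]
    exact (Rep.of S (rep_norm (hS x.1) x.2)).mul ih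

lemma rep_gens_norm (hS : ∀ i, Subgroup.closure (S i) = ⊤)
    (x : CoprodI A) : Rep (gens S) x (wordNorm (gens S) x) := by
  have := rep_lprod hS (toW x)
  rw [lprod_toW] at this
  exact this.norm

/-- `len` changes by at most one in a step -/
lemma len_step (hS : ∀ i, Subgroup.closure (S i) = ⊤)
    (g : CoprodI A) {i : ι} {s : A i} (hs : s ∈ S i ∨ s⁻¹ ∈ S i) :
    len S (toW g) ≤ len S (toW (g * CoprodI.of s)) + 1 ∧
    len S (toW (g * CoprodI.of s)) ≤ len S (toW g) + 1 := by
  obtain ⟨l, a, h1, h2⟩ := toW_step g i s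
  rw [h1, h2, len_app, len_app]
  have e1 := norm_mul_le (hS i) a s
  have e2 := norm_mul_le (hS i) (a * s) s⁻¹
  have e3 := norm_gen hs
  have e4 := norm_inv_le (hS i) s
  rw [mul_inv_cancel_right] at e2
  omega

lemma len_lip (hS : ∀ i, Subgroup.closure (S i) = ⊤)
    (l : List (CoprodI A)) (hl : ∀ t ∈ l, t ∈ gens S ∨ t⁻¹ ∈ gens S) (g : CoprodI A) :
    len S (toW g) ≤ len S (toW (g * l.prod)) + l.length ∧
    len S (toW (g * l.prod)) ≤ len S (toW g) + l.length := by
  induction l generalizing g with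
  | nil => simp
  | cons t l ih =>
    obtain ⟨i, s, hs, rfl⟩ := gens_iff S (hl t (by simp))
    have h1 := ih (fun t ht => hl t (by simp [ht])) (g * CoprodI.of s)
    have h2 := len_step hS g hs
    rw [List.prod_cons, ← mul_assoc, List.length_cons]
    omega

/-- The list `L` starts with `p` followed by a syllable in the factor `i`. -/
def Pre (p : List (Σ i, A i)) (i : ι) (b : A i) (L : List (Σ i, A i)) : Prop :=
  ∃ t, L = p ++ ⟨i, b⟩ :: t

lemma pre_step {p : List (Σ i, A i)} {i j : ι} {b : A i} {l : List (Σ i, A i)} {a s : A j}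
    (h : Pre p i b (app l j a)) :
    Pre p i b (app l j (a * s)) ∨
    ∃ (h : j = i), l = p ∧ h ▸ a = b := by
  obtain ⟨t, ht⟩ := h
  have triv : ∀ l' c, l = p ++ ⟨i, b⟩ :: l' → Pre p i b (app l j c) := by
    intro l' c h
    by_cases hc : c = 1
    · subst hc; exact ⟨l', by rw [app_one, h]⟩
    · exact ⟨l' ++ [⟨j, c⟩], by rw [app_ne _ _ hc, h]; simp⟩
  by_cases ha : a = 1
  · subst ha
    rw [app_one] at ht
    exact Or.inl (triv t _ ht)
  · rw [app_ne _ _ ha] at ht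
    rcases List.eq_nil_or_concat t with rfl | ⟨t', x, rfl⟩
    · right
      obtain ⟨h1, h2⟩ := List.append_inj' ht rfl
      simp only [List.cons.injEq, and_true, Sigma.mk.injEq] at h2
      obtain ⟨rfl, h2⟩ := h2
      exact ⟨rfl, h1, eq_of_heq h2⟩
    · left
      rw [List.concat_eq_append, ← List.cons_append, ← List.append_assoc] at ht
      exact triv t' _ (List.append_inj' ht rfl).1

/-- Leaving the branch at `p` requires going through `p`. -/
lemma leave (hS : ∀ i, Subgroup.closure (S i) = ⊤)
    (p : List (Σ i, A i)) (i : ι) (l : List (CoprodI A))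
    (hl : ∀ t ∈ l, t ∈ gens S ∨ t⁻¹ ∈ gens S) (g : CoprodI A)
    (b : A i) (h : Pre p i b (toW g)) (h' : ∀ b, ¬ Pre p i b (toW (g * l.prod))) :
    len S (toW g) ≤ len S p + l.length := by
  induction l generalizing g b with
  | nil => exact absurd h (by simpa using h' b)
  | cons t l ih =>
    obtain ⟨j, s, hs, rfl⟩ := gens_iff S (hl t (by simp))
    have h2 := len_step hS g hs
    rw [List.prod_cons, ← mul_assoc] at h'
    rw [List.length_cons]
    by_cases hP : ∃ b', Pre p i b' (toW (g * CoprodI.of s))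
    · obtain ⟨b', hb'⟩ := hP
      have := ih (fun t ht => hl t (by simp [ht])) _ b' hb' h'
      omega
    · obtain ⟨m, a, e1, e2⟩ := toW_step g j s
      rw [e1] at h
      rcases pre_step (s := s) h with h | ⟨rfl, rfl, rfl⟩
      · exact absurd ⟨b, e2 ▸ h⟩ hP
      · have : a * s = 1 := by
          by_contra hne
          exact hP ⟨a * s, [], by rw [e2, app_ne _ _ hne]⟩
        rw [e2, this, app_one] at h2
        omega

/-- projection relation -/
def Hd (p : List (Σ i, A i)) (i : ι) (b : A i) (L : List (Σ i, A i)) : Prop :=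
  Pre p i b L ∨ (b = 1 ∧ ∀ c, ¬ Pre p i c L)

lemma Pre.unique {p : List (Σ i, A i)} {i : ι} {b c : A i} {L : List (Σ i, A i)}
    (h : Pre p i b L) (h' : Pre p i c L) : b = c := by
  obtain ⟨t, rfl⟩ := h
  obtain ⟨t', h'⟩ := h'
  have := List.append_cancel_left h'
  simp at this
  exact this.1

lemma hd_step_aux {p : List (Σ i, A i)} {i : ι} {b : A i} {g : CoprodI A} {j : ι} {s : A j}
    (hs : s ∈ S j ∨ s⁻¹ ∈ S j) (h : Pre p i b (toW g)) :
    ∃ c, Hd p i c (toW (g * CoprodI.of s)) ∧ wordNorm (S i) (b⁻¹ * c) ≤ 1 := by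
  obtain ⟨m, a, e1, e2⟩ := toW_step g j s
  rw [e1] at h
  rcases pre_step (s := s) h with h | ⟨rfl, rfl, rfl⟩
  · exact ⟨b, Or.inl (e2 ▸ h), by simp [norm_one]⟩
  · refine ⟨a * s, ?_, by simpa using norm_gen hs⟩
    rw [e2]
    by_cases hne : a * s = 1
    · rw [hne, app_one]
      refine Or.inr ⟨rfl, ?_⟩
      rintro c ⟨t, ht⟩
      simp at ht
    · rw [app_ne _ _ hne]
      exact Or.inl ⟨[], rfl⟩

lemma hd_step (hS : ∀ i, Subgroup.closure (S i) = ⊤)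
    {p : List (Σ i, A i)} {i : ι} {b : A i} {g : CoprodI A} {j : ι} {s : A j}
    (hs : s ∈ S j ∨ s⁻¹ ∈ S j) (h : Hd p i b (toW g)) :
    ∃ c, Hd p i c (toW (g * CoprodI.of s)) ∧ wordNorm (S i) (b⁻¹ * c) ≤ 1 := by
  rcases h with h | ⟨rfl, h⟩
  · exact hd_step_aux hs h
  · by_cases hP : ∃ c, Pre p i c (toW (g * CoprodI.of s))
    · obtain ⟨c, hc⟩ := hP
      refine ⟨c, Or.inl hc, ?_⟩
      have hs' : s⁻¹ ∈ S j ∨ s⁻¹⁻¹ ∈ S j := by rw [inv_inv]; exact hs.symm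
      obtain ⟨d, hd, hn⟩ := hd_step_aux hs' hc
      rw [map_inv, mul_inv_cancel_right] at hd
      rcases hd with hd | ⟨rfl, -⟩
      · exact absurd hd (h d)
      · have := norm_inv_le (hS i) (c⁻¹ * 1)
        simp only [mul_one, inv_inv, inv_one, one_mul] at this hn ⊢
        omega
    · exact ⟨1, Or.inr ⟨rfl, fun c hc => hP ⟨c, hc⟩⟩, by simp [norm_one]⟩

lemma hd_lip (hS : ∀ i, Subgroup.closure (S i) = ⊤)
    (p : List (Σ i, A i)) (i : ι) (l : List (CoprodI A))
    (hl : ∀ t ∈ l, t ∈ gens S ∨ t⁻¹ ∈ gens S) (g : CoprodI A) (b : A i) (h : Hd p i b (toW g)) :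
    ∃ c, Hd p i c (toW (g * l.prod)) ∧ wordNorm (S i) (b⁻¹ * c) ≤ l.length := by
  induction l generalizing g b with
  | nil => exact ⟨b, by simpa using h, by simp [norm_one]⟩
  | cons t l ih =>
    obtain ⟨j, s, hs, rfl⟩ := gens_iff S (hl t (by simp))
    obtain ⟨c, hc, hn⟩ := hd_step hS hs h
    obtain ⟨d, hd, hm⟩ := ih (fun t ht => hl t (by simp [ht])) _ c hc
    refine ⟨d, by rwa [List.prod_cons, ← mul_assoc], ?_⟩
    have := norm_mul_le (hS i) (b⁻¹ * c) (c⁻¹ * d)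
    rw [mul_assoc, mul_inv_cancel_left] at this
    rw [List.length_cons]
    omega

lemma dist_list (hS : ∀ i, Subgroup.closure (S i) = ⊤)
    (g h : CoprodI A) : ∃ l : List (CoprodI A),
    l.length = wordNorm (gens S) (g⁻¹ * h) ∧ (∀ t ∈ l, t ∈ gens S ∨ t⁻¹ ∈ gens S) ∧
    g * l.prod = h := by
  obtain ⟨l, h1, h2, h3⟩ := rep_gens_norm hS (g⁻¹ * h)
  exact ⟨l, h1, h2, by rw [h3]; simp⟩

lemma len_dist (hS : ∀ i, Subgroup.closure (S i) = ⊤)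
    (g h : CoprodI A) :
    len S (toW g) ≤ len S (toW h) + wordNorm (gens S) (g⁻¹ * h) ∧
    len S (toW h) ≤ len S (toW g) + wordNorm (gens S) (g⁻¹ * h) := by
  obtain ⟨l, h1, h2, h3⟩ := dist_list hS g h
  have := len_lip hS l h2 g
  rwa [h3, h1] at this

lemma leave_dist (hS : ∀ i, Subgroup.closure (S i) = ⊤)
    {p : List (Σ i, A i)} {i : ι} {g h : CoprodI A} {b : A i}
    (hg : Pre p i b (toW g)) (hh : ∀ b, ¬ Pre p i b (toW h)) :
    len S (toW g) ≤ len S p + wordNorm (gens S) (g⁻¹ * h) := by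
  obtain ⟨l, h1, h2, h3⟩ := dist_list hS g h
  subst h3
  exact h1 ▸ leave hS p i l h2 g b hg hh

lemma leave_dist' (hS : ∀ i, Subgroup.closure (S i) = ⊤)
    {p : List (Σ i, A i)} {i : ι} {g h : CoprodI A} {b : A i}
    (hg : Pre p i b (toW g)) (hh : ∀ b, ¬ Pre p i b (toW h)) :
    len S (toW g) ≤ len S p + wordNorm (gens S) (h⁻¹ * g) := by
  have h1 := leave_dist hS hg hh
  have h2 := (rep_gens_norm hS (h⁻¹ * g)).inv.norm_le
  rw [mul_inv_rev, inv_inv] at h2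
  omega

lemma hd_dist (hS : ∀ i, Subgroup.closure (S i) = ⊤)
    {p : List (Σ i, A i)} {i : ι} {g h : CoprodI A} {b c : A i}
    (hg : Pre p i b (toW g)) (hh : Pre p i c (toW h)) :
    wordNorm (S i) (b⁻¹ * c) ≤ wordNorm (gens S) (g⁻¹ * h) := by
  obtain ⟨l, h1, h2, h3⟩ := dist_list hS g h
  obtain ⟨d, hd, hn⟩ := hd_lip hS p i l h2 g b (Or.inl hg)
  rw [h3] at hd
  rcases hd with hd | ⟨-, hd⟩
  · rw [hh.unique hd, ← h1]; exact hn
  · exact absurd hh (hd c)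

variable (S) in
lemma exists_split (L : List (Σ i, A i)) (N : ℕ) (h : N < len S L) :
    ∃ p i a, Pre p i a L ∧ len S p ≤ N ∧ N < len S p + wordNorm (S i) a := by
  induction L using List.reverseRecOn with
  | nil => simp at h
  | append_singleton L x ih =>
    by_cases hL : N < len S L
    · obtain ⟨p, i, a, ⟨t, rfl⟩, h1⟩ := ih hL
      exact ⟨p, i, a, ⟨t ++ [x], by simp⟩, h1⟩
    · exact ⟨L, x.1, x.2, ⟨[], rfl⟩, by omega, by simpa using h⟩

lemma prefix_unique {L : List (Σ i, A i)} {N : ℕ} {p p' : List (Σ i, A i)} {i i' : ι} {a : A i}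
    {b : A i'} (h : Pre p i a L) (h' : Pre p' i' b L) (hp : N < len S p + wordNorm (S i) a)
    (hp' : len S p' ≤ N) : p' <+: p := by
  obtain ⟨t, ht⟩ := h
  obtain ⟨t', ht'⟩ := h'
  have h1 : (p ++ [⟨i, a⟩]) <+: L := ⟨t, by rw [ht]; simp⟩
  have h2 : p' <+: L := ⟨_, ht'.symm⟩
  rcases List.prefix_or_prefix_of_prefix h1 h2 with ⟨u, hu⟩ | h3
  · rw [← hu] at hp'
    simp at hp'
    omega
  · rcases List.prefix_concat_iff.1 h3 with h4 | h4
    · rw [h4] at hp'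
      simp at hp'
      omega
    · exact h4

/-- Main separation lemma. -/
lemma separate (hS : ∀ i, Subgroup.closure (S i) = ⊤)
    {N r : ℕ} {p p' : List (Σ i, A i)} {i i' : ι} {a : A i} {a' : A i'}
    {g g' : CoprodI A} (h : Pre p i a (toW g)) (h' : Pre p' i' a' (toW g'))
    (hp : len S p ≤ N) (hp' : len S p' ≤ N) (ha : N < len S p + wordNorm (S i) a)
    (ha' : N < len S p' + wordNorm (S i') a') (hg : N + r ≤ len S (toW g))
    (hg' : N + r ≤ len S (toW g')) :
    r ≤ wordNorm (gens S) (g⁻¹ * g') ∨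
      (p = p' ∧ ∃ e : i = i', wordNorm (S i') ((e ▸ a)⁻¹ * a') ≤ wordNorm (gens S) (g⁻¹ * g')) := by
  by_cases h1 : ∀ b, ¬ Pre p i b (toW g')
  · left
    have := leave_dist hS h h1
    omega
  by_cases h2 : ∀ b, ¬ Pre p' i' b (toW g)
  · left
    have := leave_dist' hS h' h2
    omega
  right
  push Not at h1 h2
  obtain ⟨b, hb⟩ := h1
  obtain ⟨b', hb'⟩ := h2
  have e1 := prefix_unique h hb' ha hp'
  have e2 := prefix_unique h' hb ha' hp
  have e : p = p' := e2.eq_of_length (le_antisymm e2.length_le e1.length_le)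
  subst e
  refine ⟨rfl, ?_⟩
  obtain ⟨t, ht⟩ := h
  obtain ⟨t', ht'⟩ := hb'
  have h3 := List.append_cancel_left (ht.symm.trans ht')
  simp only [List.cons.injEq, Sigma.mk.injEq] at h3
  obtain ⟨⟨rfl, -⟩, -⟩ := h3
  exact ⟨rfl, hd_dist hS ⟨t, ht⟩ h'⟩

end Words

/-- The pieces of the cover. -/
def Om {ι : Type*} {A : ι → Type*} [∀ i, Group (A i)] (S : ∀ i, Set (A i)) (r m : ℕ)
    (p : List (Σ i, A i)) (i : ι) (U : Set (A i)) : Set (CoprodI A) :=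
  {g | (m + 1) * r ≤ len S (toW g) ∧ len S (toW g) < (m + 2) * r ∧ len S p ≤ m * r ∧
    ∃ a ∈ U, Pre p i a (toW g) ∧ m * r < len S p + wordNorm (S i) a}

/-- The central ball. -/
def Bl {ι : Type*} {A : ι → Type*} [∀ i, Group (A i)] (S : ∀ i, Set (A i)) (r : ℕ) :
    Set (CoprodI A) := {g | len S (toW g) < r}

theorem main {k : ℕ} {A : Fin k → Type*} [∀ i, Group (A i)]
    (S : ∀ i, Set (A i)) (hS : ∀ i, Subgroup.closure (S i) = ⊤)
    (n : ℕ)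
    (hA : ∀ i, AsdimOnLE (wordDist (S i)) (Set.univ : Set (A i)) n) :
    AsdimOnLE (wordDist (gens S)) (Set.univ : Set (CoprodI A)) (2 * n + 1) := by
  intro d hd
  choose R 𝒰 _ hcov hdis hbd using fun i => hA i d hd
  set r : ℕ := ⌈d⌉₊ with hr
  have hdr : d ≤ r := Nat.le_ceil d
  have hr0 : 0 < r := Nat.ceil_pos.2 hd
  have e : Fin (2 * n + 1 + 1) ≃ Fin 2 × Fin (n + 1) :=
    (finCongr (by ring)).trans finProdFinEquiv.symm
  refine ⟨4 * r + ∑ i, |R i|, fun q => {V | ((e q).1 = 0 ∧ V = Bl S r) ∨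
    ∃ m p i, ∃ U ∈ 𝒰 i (e q).2, (e q).1.val = (m + 1) % 2 ∧ V = Om S r m p i U}, ?_, ?_, ?_, ?_⟩
  · intros; exact Set.subset_univ _
  · intro g _
    by_cases hg : len S (toW g) < r
    · exact ⟨e.symm (0, 0), Bl S r, Or.inl (by simp), hg⟩
    · obtain ⟨m, hm⟩ : ∃ m, len S (toW g) / r = m + 1 :=
        Nat.exists_eq_succ_of_ne_zero (Nat.div_pos (not_lt.1 hg) hr0).ne'
      have h1 : (m + 1) * r ≤ len S (toW g) := hm ▸ Nat.div_mul_le_self _ _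
      have h2 : len S (toW g) < (m + 2) * r := by
        have := Nat.lt_mul_of_div_lt (show len S (toW g) / r < m + 2 by omega) hr0
        nlinarith
      obtain ⟨p, i, a, h3, h4, h5⟩ := exists_split S (toW g) (m * r) (by nlinarith)
      obtain ⟨c, U, hU, haU⟩ := hcov i a (Set.mem_univ _)
      refine ⟨e.symm (⟨(m + 1) % 2, Nat.mod_lt _ (by norm_num)⟩, c), Om S r m p i U,
        Or.inr ⟨m, p, i, U, by simpa using hU, by simp, rfl⟩, h1, h2, h4, a, haU, h3, h5⟩
  · intro q
    have lower : ∀ x y : CoprodI A, r ≤ wordNorm (gens S) (x⁻¹ * y) → d ≤ wordDist (gens S) x y :=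
      fun x y h => hdr.trans (by unfold wordDist; exact_mod_cast h)
    rintro V (⟨h1, rfl⟩ | ⟨m, p, i, U, hU, h1, rfl⟩) V' (⟨h2, rfl⟩ | ⟨m', p', i', U', hU', h2, rfl⟩)
      hne x hx y hy
    · exact absurd rfl hne
    · apply lower
      have hl := len_dist hS x y
      obtain ⟨h3, -⟩ := hy
      have hx : len S (toW x) < r := hx
      rw [h1] at h2
      have : 1 ≤ m' := by
        rcases Nat.eq_zero_or_pos m' with rfl | h
        · simp at h2
        · exact h
      nlinarith
    · apply lower
      have hl := len_dist hS x y
      obtain ⟨h3, -⟩ := hx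
      have hy : len S (toW y) < r := hy
      rw [h2] at h1
      have : 1 ≤ m := by
        rcases Nat.eq_zero_or_pos m with rfl | h
        · simp at h1
        · exact h
      nlinarith
    · have hl := len_dist hS x y
      obtain ⟨x1, x2, x3, a, haU, x4, x5⟩ := hx
      obtain ⟨y1, y2, y3, b, hbU, y4, y5⟩ := hy
      rcases lt_trichotomy m m' with hlt | rfl | hlt
      · apply lower
        have : m + 2 ≤ m' := by omega
        nlinarith
      · rcases separate hS (r := r) x4 y4 x3 y3 x5 y5 (by linarith) (by linarith)
          with h | ⟨rfl, rfl, h⟩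
        · exact lower x y h
        · have hUU : U ≠ U' := by rintro rfl; exact hne rfl
          refine (hdis i _ U hU U' hU' hUU a haU b hbU).trans ?_
          unfold wordDist
          exact_mod_cast h
      · apply lower
        have : m' + 2 ≤ m := by omega
        nlinarith
  · have hsum : 0 ≤ ∑ i, |R i| := Finset.sum_nonneg fun i _ => abs_nonneg _
    rintro q V (⟨-, rfl⟩ | ⟨m, p, i, U, hU, -, rfl⟩) x hx y hy
    · have h1 := rep_lprod hS (toW x)
      have h2 := rep_lprod hS (toW y)
      rw [lprod_toW] at h1 h2
      have h3 := (h1.inv.mul h2).norm_le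
      have hx : len S (toW x) < r := hx
      have hy : len S (toW y) < r := hy
      have h4 : wordNorm (gens S) (x⁻¹ * y) ≤ 4 * r := by omega
      have h5 : (wordNorm (gens S) (x⁻¹ * y) : ℝ) ≤ 4 * r := by exact_mod_cast h4
      unfold wordDist
      linarith
    · obtain ⟨x1, x2, x3, a, haU, ⟨s, hs⟩, x5⟩ := hx
      obtain ⟨y1, y2, y3, b, hbU, ⟨t, ht⟩, y5⟩ := hy
      have hR := hbd i _ U hU a haU b hbU
      have hRi : R i ≤ ∑ i, |R i| := (le_abs_self _).trans
        (Finset.single_le_sum (f := fun i => |R i|) (fun i _ => abs_nonneg _) (Finset.mem_univ i))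
      have hxy : x⁻¹ * y = (lprod s)⁻¹ * CoprodI.of (a⁻¹ * b) * lprod t := by
        rw [← lprod_toW x, ← lprod_toW y, hs, ht]
        simp only [lprod_append, lprod_cons, map_mul, map_inv]
        group
      have h3 := (((rep_lprod hS s).inv.mul (Rep.of S (rep_norm (hS i) (a⁻¹ * b)))).mul
        (rep_lprod hS t)).norm_le
      rw [← hxy] at h3
      rw [hs] at x2
      rw [ht] at y2
      simp only [len_append, len_cons] at x2 y2
      have h4 : wordNorm (gens S) (x⁻¹ * y) ≤ 4 * r + wordNorm (S i) (a⁻¹ * b) := by nlinarith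
      have h5 : (wordNorm (gens S) (x⁻¹ * y) : ℝ) ≤ 4 * r + wordNorm (S i) (a⁻¹ * b) := by
        exact_mod_cast h4
      unfold wordDist at hR ⊢
      linarith

end FPAsdim

/-- **Corollary to Theorem 4.** If `A 1, …, A k` are finitely generated groups with
`asdim (A i) ≤ n`, then the free product satisfies
`asdim (A 1 ∗ ⋯ ∗ A k) ≤ 2n + 1` (with the word metric coming from the union of the
finite generating sets of the factors). -/
theorem asdim_free_product_le {k : ℕ} {A : Fin k → Type*} [∀ i, Group (A i)]
    (S : ∀ i, Finset (A i)) (hS : ∀ i, Subgroup.closure ((S i : Set (A i))) = ⊤)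
    (n : ℕ)
    (hA : ∀ i, AsdimOnLE (wordDist ((S i : Set (A i)))) (Set.univ : Set (A i)) n) :
    AsdimOnLE
      (wordDist (⋃ i, (Monoid.CoprodI.of (M := A)) '' (S i : Set (A i))))
      (Set.univ : Set (Monoid.CoprodI A)) (2 * n + 1) := by
  exact FPAsdim.main (fun i => (S i : Set (A i))) hS n hA
end

section
/- Let A and B be finitely generated groups with asdim A ≤ n and asdim B ≤ n, and let C be a common subgroup of A and B. Then the amalgamated free product satisfies asdim (A ∗_C B) ≤ 2n + 1. -/
namespace AsdimAux
open Relation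


structure AMet {X : Type*} (δ : X → X → ℕ) : Prop where
  self : ∀ x, δ x x = 0
  symm : ∀ x y, δ x y = δ y x
  tri : ∀ x y z, δ x z ≤ δ x y + δ y z

def AStp {X κ : Type*} (δ : X → X → ℕ) (col : X → κ) (Y : Set X) (d : ℕ) (x y : X) : Prop :=
  x ∈ Y ∧ y ∈ Y ∧ col x = col y ∧ δ x y < d

def ACov {X κ : Type*} (δ : X → X → ℕ) (col : X → κ) (Y : Set X) (d R : ℕ) : Prop :=
  ∀ x y, ReflTransGen (AStp δ col Y d) x y → δ x y ≤ R

def AAsd {X : Type*} (δ : X → X → ℕ) (n : ℕ) (Y : Set X) : Prop :=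
  ∀ d, ∃ R, ∃ col : X → Fin (n + 1), ACov δ col Y d R

theorem AStp.mono {X κ : Type*} {δ : X → X → ℕ} {col : X → κ} {Y Y' : Set X} {d d' : ℕ}
    (h : Y ⊆ Y') (hd : d ≤ d') {x y : X} (hs : AStp δ col Y d x y) : AStp δ col Y' d' x y :=
  ⟨h hs.1, h hs.2.1, hs.2.2.1, lt_of_lt_of_le hs.2.2.2 hd⟩

theorem ACov.mono {X κ : Type*} {δ : X → X → ℕ} {col : X → κ} {Y Y' : Set X} {d R : ℕ}
    (h : Y ⊆ Y') (hc : ACov δ col Y' d R) : ACov δ col Y d R :=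
  fun x y hxy => hc x y (ReflTransGen.mono (fun _ _ hs => hs.mono h le_rfl) _ _ hxy)

theorem AAsd.mono {X : Type*} {δ : X → X → ℕ} {n : ℕ} {Y Y' : Set X}
    (h : Y ⊆ Y') (hc : AAsd δ n Y') : AAsd δ n Y := fun d => by
  obtain ⟨R, col, hR⟩ := hc d
  exact ⟨R, col, hR.mono h⟩

/-- pieces lemma -/
theorem ACov.pieces {X κ ι : Type*} {δ : X → X → ℕ} {Z : Set X} {d R : ℕ}
    (q : X → ι) (cols : ι → X → κ)
    (hq : ∀ x ∈ Z, ∀ y ∈ Z, cols (q x) x = cols (q y) y → δ x y < d → q x = q y)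
    (hc : ∀ i, ACov δ (cols i) {x | x ∈ Z ∧ q x = i} d R) :
    ACov δ (fun x => cols (q x) x) Z d R := by
  intro x y hxy
  have key : q y = q x ∧ ReflTransGen (AStp δ (cols (q x)) {z | z ∈ Z ∧ q z = q x} d) x y := by
    induction hxy with
    | refl => exact ⟨rfl, .refl⟩
    | tail _ hs ih =>
      obtain ⟨h1, h2, h3, h4⟩ := hs
      have h5 := hq _ h1 _ h2 h3 h4
      refine ⟨h5 ▸ ih.1, ih.2.tail ⟨⟨h1, ih.1⟩, ⟨h2, h5 ▸ ih.1⟩, ?_, h4⟩⟩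
      have h6 := ih.1
      dsimp only at h3
      rw [← h5, h6] at h3
      exact h3
  exact hc _ _ _ key.2

open Classical in
/-- saturated union -/
theorem ACov.union {X κ : Type*} {δ : X → X → ℕ} (hδ : AMet δ) {Y Z : Set X} {d R R' : ℕ}
    {cY cZ : X → κ} (hZ : ACov δ cZ Z d R) (hY : ACov δ cY Y (R + 2 * d + 1) R') :
    ACov δ (fun x => if x ∈ Y then cY x else cZ x) (Z ∪ Y) d (R' + 2 * R + 2 * d) := by
  set col : X → κ := fun x => if x ∈ Y then cY x else cZ x with hcol
  intro x y hxy
  have key : ReflTransGen (AStp δ cZ Z d) x y ∧ y ∉ Y ∨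
      ∃ u v, δ x u ≤ R + d ∧ v ∈ Y ∧ ReflTransGen (AStp δ cY Y (R + 2 * d + 1)) u v ∧
        col v = col y ∧
        ((y = v) ∨ (∃ w, δ v w < d ∧ y ∉ Y ∧ ReflTransGen (AStp δ cZ Z d) w y)) := by
    induction hxy with
    | refl =>
      by_cases hx : x ∈ Y
      · exact .inr ⟨x, x, by simp [hδ.self], hx, .refl, rfl, .inl rfl⟩
      · exact .inl ⟨.refl, hx⟩
    | @tail a b _ hs ih =>
      obtain ⟨h1, h2, h3, h4⟩ := hs
      by_cases hb : b ∈ Y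
      · right
        rcases ih with ⟨ih, ha⟩ | ⟨u, v, h5, h6, h7, h8, h9⟩
        · refine ⟨b, b, ?_, hb, .refl, rfl, .inl rfl⟩
          have := hZ _ _ ih
          have := hδ.tri x a b
          omega
        · refine ⟨u, b, h5, hb, h7.tail ⟨h6, hb, ?_, ?_⟩, rfl, .inl rfl⟩
          · have := h8.trans h3
            simpa [hcol, h6, hb] using this
          · rcases h9 with rfl | ⟨w, h10, _, h11⟩
            · omega
            · have := hZ _ _ h11
              have := hδ.tri v w b
              have := hδ.tri w a b
              omega
      · have hbZ : b ∈ Z := h2.resolve_right hb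
        rcases ih with ⟨ih, ha⟩ | ⟨u, v, h5, h6, h7, h8, h9⟩
        · left
          refine ⟨ih.tail ⟨h1.resolve_right ha, hbZ, ?_, h4⟩, hb⟩
          simpa [hcol, ha, hb] using h3
        · right
          refine ⟨u, v, h5, h6, h7, h8.trans h3, .inr ?_⟩
          rcases h9 with rfl | ⟨w, h10, ha, h11⟩
          · exact ⟨b, h4, hb, .refl⟩
          · refine ⟨w, h10, hb, h11.tail ⟨h1.resolve_right ha, hbZ, ?_, h4⟩⟩
            simpa [hcol, ha, hb] using h3
  rcases key with ⟨h, _⟩ | ⟨u, v, h5, h6, h7, h8, h9⟩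
  · have := hZ _ _ h
    omega
  · have h10 := hY _ _ h7
    have := hδ.tri x u y
    have := hδ.tri u v y
    rcases h9 with rfl | ⟨w, h12, _, h11⟩
    · omega
    · have := hZ _ _ h11
      have := hδ.tri v w y
      omega

theorem AAsd.union {X : Type*} {δ : X → X → ℕ} (hδ : AMet δ) {n : ℕ} {Y Z : Set X}
    (hZ : AAsd δ n Z) (hY : AAsd δ n Y) : AAsd δ n (Z ∪ Y) := by
  intro d
  obtain ⟨R, c, h⟩ := hZ d
  obtain ⟨R', c', h'⟩ := hY (R + 2 * d + 1)
  exact ⟨_, _, h.union hδ h'⟩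

/-- neighbourhoods -/
theorem AAsd.nbhd {X : Type*} {δ : X → X → ℕ} (hδ : AMet δ) {n : ℕ} {Y : Set X}
    (hY : AAsd δ n Y) (r : ℕ) : AAsd δ n {x | ∃ z ∈ Y, δ x z < r} := by
  intro d
  obtain ⟨R, c, h⟩ := hY (d + 2 * r)
  have : ∀ x, ∃ z, (∃ z ∈ Y, δ x z < r) → z ∈ Y ∧ δ x z < r := fun x => by
    by_cases hx : ∃ z ∈ Y, δ x z < r
    · obtain ⟨z, hz⟩ := hx
      exact ⟨z, fun _ => hz⟩
    · exact ⟨x, fun h => absurd h hx⟩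
  choose f hf using this
  refine ⟨R + 2 * r, fun x => c (f x), ?_⟩
  intro x y hxy
  rcases ReflTransGen.cases_head hxy with rfl | ⟨b, hb, _⟩
  · simp [hδ.self]
  have hx := hf x hb.1
  have hy : y ∈ {x | ∃ z ∈ Y, δ x z < r} := by
    rcases ReflTransGen.cases_tail hxy with rfl | ⟨b, _, hb⟩
    · exact ⟨_, hx⟩
    · exact hb.2.1
  have hy := hf y hy
  have h1 : ReflTransGen (AStp δ c Y (d + 2 * r)) (f x) (f y) := by
    refine ReflTransGen.lift f ?_ _ _ hxy
    rintro a b ⟨h1, h2, h3, h4⟩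
    have ha := hf a h1
    have hb := hf b h2
    refine ⟨ha.1, hb.1, h3, ?_⟩
    have := hδ.tri (f a) a (f b)
    have := hδ.tri a b (f b)
    have := hδ.symm a (f a)
    omega
  have := h _ _ h1
  have := hδ.tri x (f x) y
  have := hδ.tri (f x) (f y) y
  have := hδ.symm y (f y)
  omega

/-- transfer along maps -/
theorem ACov.comap {X X' κ : Type*} {δ : X → X → ℕ} {δ' : X' → X' → ℕ} {Y : Set X} {Y' : Set X'}
    (f : X → X') {c : X' → κ} {d d' R R' : ℕ} (h : ACov δ' c Y' d' R')
    (hself : ∀ x, δ x x = 0)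
    (hf : ∀ x ∈ Y, f x ∈ Y') (hd : ∀ x ∈ Y, ∀ y ∈ Y, δ x y < d → δ' (f x) (f y) < d')
    (hR : ∀ x ∈ Y, ∀ y ∈ Y, δ' (f x) (f y) ≤ R' → δ x y ≤ R) :
    ACov δ (fun x => c (f x)) Y d R := by
  intro x y hxy
  rcases ReflTransGen.cases_head hxy with rfl | ⟨b, hb, _⟩
  · simp [hself]
  have hy : y ∈ Y := by
    rcases ReflTransGen.cases_tail hxy with rfl | ⟨b, _, hb⟩
    · exact hb.1
    · exact hb.2.1
  refine hR x hb.1 y hy (h _ _ (ReflTransGen.lift f ?_ _ _ hxy))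
  rintro a b ⟨h1, h2, h3, h4⟩
  exact ⟨hf _ h1, hf _ h2, h3, hd _ h1 _ h2 h4⟩

section tree

variable {G : Type*} [Group G] {α : Type*} (N : G → ℕ) (M : G → List α) (E P : Set G)

theorem tree_lip (hpath : ∀ x, ∃ l : List G, l.length = N x ∧ (∀ g ∈ l, g ∈ E) ∧ l.prod = x)
    (hM : ∀ x, ∀ s ∈ E, ∃ a b t, M x = a ++ t ∧ M (x * s) = b ++ t ∧ a.length ≤ 1 ∧ b.length ≤ 1)
    (x y : G) : (M x).length ≤ (M y).length + N (x⁻¹ * y) := by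
  have key : ∀ l : List G, (∀ g ∈ l, g ∈ E) → ∀ x,
      (M x).length ≤ (M (x * l.prod)).length + l.length := by
    intro l
    induction l with
    | nil => simp
    | cons s l ih =>
      intro hl x
      have h1 := ih (fun g hg => hl g (by simp [hg])) (x * s)
      obtain ⟨a, b, t, h2, h3, h4, h5⟩ := hM x s (hl s (by simp))
      rw [List.prod_cons, ← mul_assoc]
      rw [h3] at h1
      rw [h2]
      simp at h1 ⊢
      omega
  obtain ⟨l, h1, h2, h3⟩ := hpath (x⁻¹ * y)
  have := key l h2 x
  rw [h3, h1] at this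
  simpa using this

theorem rtake_app (a t : List α) (k : ℕ) (hk : k ≤ t.length) : (a ++ t).rtake k = t.rtake k := by
  have h : (a ++ t).length - k = a.length + (t.length - k) := by
    rw [List.length_append]
    omega
  rw [List.rtake, h, List.drop_append, List.rtake]
  simp

theorem tree_sep (hpath : ∀ x, ∃ l : List G, l.length = N x ∧ (∀ g ∈ l, g ∈ E) ∧ l.prod = x)
    (hE : ∀ l : List G, (∀ g ∈ l, g ∈ E) → N l.prod ≤ l.length)
    (hM : ∀ x, ∀ s ∈ E, ∃ a b t, M x = a ++ t ∧ M (x * s) = b ++ t ∧ a.length ≤ 1 ∧ b.length ≤ 1)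
    (k : ℕ) (x y : G) (hx : k < (M x).length) (hy : k < (M y).length)
    (hxy : (M x).rtake k ≠ (M y).rtake k) :
    ∃ z, (M z).length ≤ k ∧ N (x⁻¹ * z) ≤ N (x⁻¹ * y) := by
  have key : ∀ l : List G, (∀ g ∈ l, g ∈ E) → ∀ x, k < (M x).length → 
      k < (M (x * l.prod)).length → (M x).rtake k ≠ (M (x * l.prod)).rtake k → 
      ∃ l' : List G, (∀ g ∈ l', g ∈ E) ∧ (M (x * l'.prod)).length ≤ k ∧ l'.length ≤ l.length := by
    intro l
    induction l with
    | nil => simp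
    | cons s l ih =>
      intro hl x h1 h2 h3
      by_cases h4 : (M (x * s)).length ≤ k
      · exact ⟨[s], by simpa using hl s (by simp), by simpa using h4, by simp⟩
      rw [List.prod_cons, ← mul_assoc] at h2 h3
      obtain ⟨a, b, t, h5, h6, h7, h8⟩ := hM x s (hl s (by simp))
      have h9 : (M x).rtake k = (M (x * s)).rtake k := by
        rw [h5] at h1
        rw [h6] at h4
        rw [h5, h6]
        simp only [List.length_append] at h1 h4
        rw [rtake_app _ _ _ (by omega), rtake_app _ _ _ (by omega)]
      rw [h9] at h3
      obtain ⟨l', h10, h11, h12⟩ := ih (fun g hg => hl g (by simp [hg])) (x * s) (by omega) h2 h3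
      refine ⟨s :: l', ?_, ?_, by simpa using h12⟩
      · intro g hg
        rcases List.mem_cons.1 hg with rfl | hg
        · exact hl _ (by simp)
        · exact h10 _ hg
      · rwa [List.prod_cons, ← mul_assoc]
  obtain ⟨l, h1, h2, h3⟩ := hpath (x⁻¹ * y)
  obtain ⟨l', h4, h5, h6⟩ := key l h2 x hx (by simpa [h3] using hy) (by simpa [h3] using hxy)
  refine ⟨x * l'.prod, h5, ?_⟩
  have := hE l' h4
  simp only [inv_mul_cancel_left]
  omega

theorem AAsd.translate {N : G → ℕ} (hδ : AMet fun x y => N (x⁻¹ * y)) {Y Y' : Set G}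
    {κ : Type*} {c : G → κ} {d R : ℕ} (h : ACov (fun x y => N (x⁻¹ * y)) c Y' d R)
    (g : G) (hg : ∀ x ∈ Y, g * x ∈ Y') :
    ACov (fun x y => N (x⁻¹ * y)) (fun x => c (g * x)) Y d R := by
  refine h.comap (fun x => g * x) hδ.self hg ?_ ?_
  · intro x _ y _ h
    simpa [mul_assoc] using h
  · intro x _ y _ h
    simpa [mul_assoc] using h

theorem rtake_split (l : List α) (k : ℕ) :
    ∃ a, l = a ++ l.rtake k ∧ a.length = l.length - k :=
  ⟨l.take (l.length - k), by simp [List.rtake], by simp⟩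

theorem tree_level (hδ : AMet fun x y => N (x⁻¹ * y)) (n : ℕ) (pr : List α → G)
    (hpath : ∀ x, ∃ l : List G, l.length = N x ∧ (∀ g ∈ l, g ∈ E) ∧ l.prod = x)
    (hE : ∀ l : List G, (∀ g ∈ l, g ∈ E) → N l.prod ≤ l.length)
    (hM : ∀ x, ∀ s ∈ E, ∃ a b t, M x = a ++ t ∧ M (x * s) = b ++ t ∧ a.length ≤ 1 ∧ b.length ≤ 1)
    (hP : ∀ x a t, M x = a ++ t → a.length ≤ 1 → pr t * x ∈ P)
    (hPa : AAsd (fun x y => N (x⁻¹ * y)) n P) (k : ℕ) :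
    AAsd (fun x y => N (x⁻¹ * y)) n {x | (M x).length ≤ k} := by
  induction k with
  | zero =>
    intro d
    obtain ⟨R, c, h⟩ := hPa d
    refine ⟨R, _, AAsd.translate hδ h (pr []) ?_⟩
    intro x hx
    have : M x = [] := by simpa using hx
    exact hP x [] [] (by simp [this]) (by simp)
  | succ k ih =>
    intro d
    obtain ⟨R, c, h⟩ := hPa d
    obtain ⟨R', c', h'⟩ := ih.nbhd hδ (d + 1) (R + 2 * d + 1)
    set Y : Set G := {x | ∃ z ∈ {x | (M x).length ≤ k}, N (x⁻¹ * z) < d + 1}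
    have hZ : ACov (fun x y => N (x⁻¹ * y)) (fun x => c (pr ((M x).rtake k) * x))
        {x | (M x).length = k + 1 ∧ x ∉ Y} d R := by
      refine ACov.pieces (fun x => (M x).rtake k) (fun t x => c (pr t * x)) ?_ ?_
      · intro x hx y hy _ hd
        by_contra hne
        obtain ⟨z, hz, hz'⟩ := tree_sep N M E hpath hE hM k x y (by rw [hx.1]; omega)
          (by rw [hy.1]; omega) hne
        exact hx.2 ⟨z, hz, by omega⟩
      · intro t
        refine AAsd.translate hδ h (pr t) ?_
        rintro x ⟨hx, rfl⟩
        obtain ⟨a, h1, h2⟩ := rtake_split (M x) k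
        exact hP x a _ h1 (by rw [h2, hx.1]; omega)
    refine ⟨_, _, (hZ.union hδ h').mono ?_⟩
    intro x hx
    by_cases hy : x ∈ Y
    · exact .inr hy
    refine .inl ⟨?_, hy⟩
    rcases Nat.lt_or_ge (M x).length (k + 1) with h | h
    · exfalso
      exact hy ⟨x, by simpa using Nat.lt_succ_iff.1 h, by have := hδ.self x; omega⟩
    · exact le_antisymm hx h

theorem ACov.recolor {X κ κ' : Type*} {δ : X → X → ℕ} {Y : Set X} {d R : ℕ} {c : X → κ}
    {c' : X → κ'} (hc : ∀ x y, c' x = c' y → c x = c y) (h : ACov δ c Y d R) : ACov δ c' Y d R :=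
  fun x y hxy => h x y (ReflTransGen.mono
    (fun _ _ hs => ⟨hs.1, hs.2.1, hc _ _ hs.2.2.1, hs.2.2.2⟩) _ _ hxy)

theorem tree_final (hδ : AMet fun x y => N (x⁻¹ * y)) (n : ℕ) (pr : List α → G)
    (hpath : ∀ x, ∃ l : List G, l.length = N x ∧ (∀ g ∈ l, g ∈ E) ∧ l.prod = x)
    (hE : ∀ l : List G, (∀ g ∈ l, g ∈ E) → N l.prod ≤ l.length)
    (hM : ∀ x, ∀ s ∈ E, ∃ a b t, M x = a ++ t ∧ M (x * s) = b ++ t ∧ a.length ≤ 1 ∧ b.length ≤ 1)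
    (hP : ∀ x a t, M x = a ++ t → a.length ≤ 1 → pr t * x ∈ P)
    (hP2 : ∀ x a t, M x = a ++ t → (M (pr t * x)).length ≤ a.length + 1)
    (hPa : AAsd (fun x y => N (x⁻¹ * y)) n P) :
    AAsd (fun x y => N (x⁻¹ * y)) (2 * n + 1) Set.univ := by
  intro d
  set D := d + 1 with hD
  have hD0 : 0 < D := by omega
  obtain ⟨R, c, h⟩ := tree_level N M E P hδ n pr hpath hE hM hP hPa (2 * D + 1) d
  have lip := tree_lip N M E hpath hM
  let q : G → ℕ × List α := fun x =>
    ((M x).length / D, (M x).rtake (((M x).length / D - 1) * D))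
  let cols : ℕ × List α → G → Fin 2 × Fin (n + 1) := fun p x =>
    (⟨p.1 % 2, Nat.mod_lt _ (by norm_num)⟩, c (pr p.2 * x))
  have main : ACov (fun x y => N (x⁻¹ * y)) (fun x => cols (q x) x) Set.univ d R := by
    refine ACov.pieces q cols ?_ ?_
    · intro x _ y _ hc hd
      have hpar : ((M x).length / D) % 2 = ((M y).length / D) % 2 := by
        have := congrArg (fun z => (z.1 : ℕ)) hc
        simpa [cols, q] using this
      have l1 := lip x y
      have l2 := lip y x
      have hs := hδ.symm x y
      have e1 : (M x).length / D ≤ (M y).length / D + 1 := by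
        rw [← Nat.add_div_right _ hD0]
        exact Nat.div_le_div_right (by omega)
      have e2 : (M y).length / D ≤ (M x).length / D + 1 := by
        rw [← Nat.add_div_right _ hD0]
        exact Nat.div_le_div_right (by omega)
      have e3 : (M x).length / D = (M y).length / D := by omega
      have hx := Nat.div_mul_le_self (M x).length D
      have hy := Nat.div_mul_le_self (M y).length D
      refine Prod.ext e3 ?_
      simp only [q]
      rw [← e3] at hy ⊢
      generalize (M x).length / D = i at hx hy ⊢
      rcases i with _ | i
      · simp
      by_contra hne
      simp only [Nat.add_sub_cancel] at hne
      rw [Nat.succ_mul] at hx hy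
      obtain ⟨z, hz, hz'⟩ := tree_sep N M E hpath hE hM (i * D) x y (by omega) (by omega) hne
      have := lip x z
      omega
    · rintro ⟨i, t⟩
      refine ACov.recolor (c := fun x => c (pr t * x)) ?_ (AAsd.translate hδ h (pr t) ?_)
      · intro x y hxy
        exact congrArg Prod.snd hxy
      · rintro x ⟨-, hx⟩
        simp only [q, Prod.mk.injEq] at hx
        obtain ⟨hx1, hx2⟩ := hx
        rw [hx1] at hx2
        obtain ⟨a, h1, h2⟩ := rtake_split (M x) ((i - 1) * D)
        rw [hx2] at h1
        have h3 := hP2 x a t h1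
        have h4 : (M x).length < (i + 1) * D := by
          rw [← hx1]
          exact (Nat.div_lt_iff_lt_mul hD0).1 (Nat.lt_succ_self _)
        simp only [Set.mem_ofPred_eq]
        rcases i with _ | i
        · simp at h2 h4
          omega
        · simp only [Nat.add_sub_cancel] at h2
          simp only [Nat.succ_mul] at h4
          omega
  refine ⟨R, fun x => Fin.cast (by ring) (finProdFinEquiv (cols (q x) x)), main.recolor ?_⟩
  intro x y hxy
  exact finProdFinEquiv.injective (Fin.cast_injective _ hxy)

end tree

section words

variable {G : Type*} [Group G]

def AWord (S : Set G) (l : List G) : Prop := ∀ g ∈ l, g ∈ S ∨ g⁻¹ ∈ S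

theorem wordNorm_le {S : Set G} {l : List G} (hl : AWord S l) : wordNorm S l.prod ≤ l.length :=
  Nat.sInf_le ⟨l, rfl, hl, rfl⟩

theorem exists_word {S : Set G} (hS : Subgroup.closure S = ⊤) (x : G) :
    ∃ l : List G, l.length = wordNorm S x ∧ AWord S l ∧ l.prod = x := by
  have hne : {n : ℕ | ∃ l : List G, l.length = n ∧ (∀ g ∈ l, g ∈ S ∨ g⁻¹ ∈ S) ∧
      l.prod = x}.Nonempty := by
    have hx : x ∈ Subgroup.closure S := hS ▸ Subgroup.mem_top x
    rw [← Subgroup.mem_toSubmonoid, Subgroup.closure_toSubmonoid] at hx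
    obtain ⟨l, h1, h2⟩ := Submonoid.exists_list_of_mem_closure hx
    exact ⟨l.length, l, rfl, fun g hg => by simpa using h1 g hg, h2⟩
  exact Nat.sInf_mem hne

theorem word_amet {S : Set G} (hS : Subgroup.closure S = ⊤) :
    AMet fun x y : G => wordNorm S (x⁻¹ * y) where
  self x := by
    have := wordNorm_le (S := S) (l := []) (by simp [AWord])
    simpa using this
  symm := by
    have key : ∀ x : G, wordNorm S x⁻¹ ≤ wordNorm S x := by
      intro x
      obtain ⟨l, h1, h2, rfl⟩ := exists_word hS x
      rw [← h1, List.prod_inv_reverse]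
      refine (wordNorm_le ?_).trans (by simp)
      intro g hg
      simp only [List.mem_reverse, List.mem_map] at hg
      obtain ⟨a, ha, rfl⟩ := hg
      simpa using (h2 a ha).symm
    intro x y
    apply le_antisymm
    · simpa using key (y⁻¹ * x)
    · simpa using key (x⁻¹ * y)
  tri x y z := by
    obtain ⟨l, h1, h2, h3⟩ := exists_word hS (x⁻¹ * y)
    obtain ⟨l', h1', h2', h3'⟩ := exists_word hS (y⁻¹ * z)
    have h : x⁻¹ * z = (l ++ l').prod := by
      rw [List.prod_append, h3, h3']
      group
    rw [← h1, ← h1', h, ← List.length_append]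
    refine wordNorm_le ?_
    intro g hg
    rcases List.mem_append.1 hg with hg | hg
    · exact h2 g hg
    · exact h2' g hg

theorem finite_words {E : Set G} (hE : E.Finite) (d : ℕ) :
    {x : G | ∃ l : List G, l.length = d ∧ (∀ g ∈ l, g ∈ E) ∧ l.prod = x}.Finite := by
  induction d with
  | zero =>
    refine (Set.finite_singleton (1 : G)).subset ?_
    rintro x ⟨l, h1, _, rfl⟩
    simp [List.length_eq_zero_iff.1 h1]
  | succ d ih =>
    refine (hE.image2 (fun a b => a * b) ih).subset ?_
    rintro x ⟨l, h1, h2, rfl⟩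
    cases l with
    | nil => simp at h1
    | cons a l =>
      refine ⟨a, h2 a (by simp), l.prod, ⟨l, by simpa using h1, fun g hg => h2 g (by simp [hg]),
        rfl⟩, by simp⟩

theorem finite_ball {S : Set G} (hfin : S.Finite) (hS : Subgroup.closure S = ⊤) (d : ℕ) :
    {x : G | wordNorm S x < d}.Finite := by
  have hE : (S ∪ S⁻¹).Finite := hfin.union hfin.inv
  refine ((Set.finite_Iio d).biUnion fun k _ => finite_words hE k).subset ?_
  intro x hx
  obtain ⟨l, h1, h2, h3⟩ := exists_word hS x
  refine Set.mem_biUnion (x := wordNorm S x) hx ⟨l, h1, fun g hg => ?_, h3⟩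
  simpa using h2 g hg

theorem asdim_to_AAsd {S : Set G} {n : ℕ}
    (h : AsdimOnLE (wordDist S) Set.univ n) :
    AAsd (fun x y : G => wordNorm S (x⁻¹ * y)) n Set.univ := by
  intro d
  obtain ⟨R, 𝒰, -, h2, h3, h4⟩ := h (d + 1) (by positivity)
  choose col U hU hxU using fun x => h2 x (Set.mem_univ x)
  refine ⟨⌈R⌉₊, col, ?_⟩
  intro x y hxy
  have key : col y = col x ∧ U y = U x := by
    induction hxy with
    | refl => exact ⟨rfl, rfl⟩
    | @tail a b _ hs ih =>
      obtain ⟨-, -, h5, h6⟩ := hs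
      refine ⟨h5 ▸ ih.1, ?_⟩
      rw [← ih.2]
      by_contra hne
      have h7 := h3 (col a) (U a) (hU a) (U b) (h5 ▸ hU b) (Ne.symm hne) a (hxU a) b (hxU b)
      unfold wordDist at h7
      have h8 : ((wordNorm S (a⁻¹ * b) : ℕ) : ℝ) < d := by exact_mod_cast h6
      linarith
  have h9 := h4 (col x) (U x) (hU x) x (hxU x) y (key.2 ▸ hxU y)
  unfold wordDist at h9
  have := h9.trans (Nat.le_ceil R)
  exact_mod_cast this

theorem AAsd_to_asdim {S : Set G} (hS : Subgroup.closure S = ⊤) {n : ℕ}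
    (h : AAsd (fun x y : G => wordNorm S (x⁻¹ * y)) n Set.univ) :
    AsdimOnLE (wordDist S) Set.univ n := by
  intro d hd
  have hδ := word_amet hS
  obtain ⟨R, col, hc⟩ := h ⌈d⌉₊
  set r := AStp (fun x y : G => wordNorm S (x⁻¹ * y)) col Set.univ ⌈d⌉₊ with hr
  have hrs : ∀ x y, r x y → r y x := fun x y hs =>
    ⟨hs.2.1, hs.1, hs.2.2.1.symm, (hδ.symm y x).trans_lt hs.2.2.2⟩
  have hsymm : ∀ x y, ReflTransGen r x y → ReflTransGen r y x := by
    intro x y hxy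
    induction hxy with
    | refl => exact .refl
    | tail _ hs ih => exact .head (hrs _ _ hs) ih
  have hcol : ∀ x y, ReflTransGen r x y → col x = col y := by
    intro x y hxy
    induction hxy with
    | refl => rfl
    | tail _ hs ih => exact ih.trans hs.2.2.1
  refine ⟨R, fun i => {U | ∃ x, col x = i ∧ U = {y | ReflTransGen r x y}}, ?_, ?_, ?_, ?_⟩
  · intro i U _
    exact Set.subset_univ _
  · intro x _
    exact ⟨col x, _, ⟨x, rfl, rfl⟩, ReflTransGen.refl⟩
  · rintro i _ ⟨u, hu, rfl⟩ _ ⟨v, hv, rfl⟩ hne x hx y hy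
    by_contra hlt
    have hx : ReflTransGen r u x := hx
    have hy : ReflTransGen r v y := hy
    have hst : r x y := by
      refine ⟨trivial, trivial, ?_, ?_⟩
      · rw [← hcol _ _ hx, ← hcol _ _ hy, hu, hv]
      · rw [Nat.lt_ceil]
        exact not_le.1 hlt
    have huv : ReflTransGen r u v := (hx.tail hst).trans (hsymm _ _ hy)
    apply hne
    ext z
    exact ⟨fun hz => (hsymm _ _ huv).trans hz, fun hz => huv.trans hz⟩
  · rintro i _ ⟨u, hu, rfl⟩ x hx y hy
    have := hc x y ((hsymm _ _ hx).trans hy)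
    unfold wordDist
    exact_mod_cast this

theorem AAsd_range {H : Type*} [Group H] {S : Set G} (hfin : S.Finite)
    (hS : Subgroup.closure S = ⊤)
    {T : Set H} (hT : Subgroup.closure T = ⊤) (f : H →* G) (hf : Function.Injective f)
    (hTS : ∀ t ∈ T, f t ∈ S) {n : ℕ}
    (h : AAsd (fun x y : H => wordNorm T (x⁻¹ * y)) n Set.univ) :
    AAsd (fun x y : G => wordNorm S (x⁻¹ * y)) n (Set.range f) := by
  intro d
  have hb : (f ⁻¹' {x : G | wordNorm S x < d}).Finite :=
    (finite_ball hfin hS d).preimage hf.injOn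
  obtain ⟨ρ, hρ⟩ := (hb.image (wordNorm T)).bddAbove
  obtain ⟨R, c, hc⟩ := h (ρ + 1)
  refine ⟨R, _, hc.comap (Function.invFun f) (word_amet hS).self (fun _ _ => trivial) ?_ ?_⟩
  · rintro _ ⟨a, rfl⟩ _ ⟨b, rfl⟩ hab
    rw [Function.leftInverse_invFun hf a, Function.leftInverse_invFun hf b]
    refine Nat.lt_succ_iff.2 (hρ ⟨a⁻¹ * b, ?_, rfl⟩)
    simpa using hab
  · rintro _ ⟨a, rfl⟩ _ ⟨b, rfl⟩ hab
    rw [Function.leftInverse_invFun hf a, Function.leftInverse_invFun hf b] at hab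
    refine le_trans ?_ hab
    obtain ⟨l, h1, h2, h3⟩ := exists_word hT (a⁻¹ * b)
    rw [← map_inv, ← map_mul, ← h3, map_list_prod]
    refine (wordNorm_le ?_).trans ?_
    · intro g hg
      obtain ⟨t, ht, rfl⟩ := List.mem_map.1 hg
      rcases h2 t ht with h | h
      · exact .inl (hTS _ h)
      · right
        rw [← map_inv]
        exact hTS _ h
    · rw [List.length_map, h1, h3]

end words

section push

open Monoid

variable {C : Type*} [Group C] {G : Bool → Type*} [∀ b, Group (G b)] {φ : ∀ b, C →* G b}

theorem rcons_list [∀ i, DecidableEq (G i)] {d : PushoutI.NormalWord.Transversal φ} (i : Bool)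
    (p : PushoutI.NormalWord.Pair d i) :
    ∃ a, (PushoutI.NormalWord.rcons i p).toList = a ++ p.tail.toList ∧ a.length ≤ 1 := by
  simp only [PushoutI.NormalWord.rcons, CoprodI.Word.equivPair_symm, CoprodI.Word.rcons]
  split_ifs
  · exact ⟨[], by simp⟩
  · exact ⟨[_], by simp [CoprodI.Word.cons]; rfl⟩

open Classical in
theorem smul_list {d : PushoutI.NormalWord.Transversal φ} (i : Bool) (g : G i)
    (w : PushoutI.NormalWord d) :
    ∃ a b t, w.toList = a ++ t ∧ (PushoutI.of (φ := φ) i g • w).toList = b ++ t ∧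
      a.length ≤ 1 ∧ b.length ≤ 1 := by
  obtain ⟨a, h1, h2⟩ := rcons_list i (PushoutI.NormalWord.equivPair i w)
  obtain ⟨b, h3, h4⟩ := rcons_list i { PushoutI.NormalWord.equivPair i w with
        head := g * (PushoutI.NormalWord.equivPair i w).head }
  have h5 : PushoutI.NormalWord.rcons i (PushoutI.NormalWord.equivPair i w) = w :=
    (PushoutI.NormalWord.equivPair i).symm_apply_apply w
  rw [h5] at h1
  exact ⟨a, b, _, h1, h3, h2, h4⟩

def lprod (l : List (Σ i, G i)) : PushoutI φ :=
  (l.map fun p => PushoutI.of (φ := φ) p.1 p.2).prod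

theorem ofCoprod_prod (w : CoprodI.Word G) :
    PushoutI.ofCoprodI (φ := φ) w.prod = lprod w.toList := by
  rw [CoprodI.Word.prod, map_list_prod, lprod, List.map_map]
  congr 1

open Classical in
theorem lprod_smul_len {d : PushoutI.NormalWord.Transversal φ} (l : List (Σ i, G i)) :
    (lprod (φ := φ) l • (PushoutI.NormalWord.empty : PushoutI.NormalWord d)).toList.length
      ≤ l.length := by
  induction l with
  | nil => simp [lprod]
  | cons p l ih =>
    have h : lprod (φ := φ) (p :: l) = PushoutI.of p.1 p.2 * lprod l := by simp [lprod]
    rw [h, mul_smul]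
    obtain ⟨a, b, t, h1, h2, h3, h4⟩ := smul_list p.1 p.2
      (lprod (φ := φ) l • (PushoutI.NormalWord.empty : PushoutI.NormalWord d))
    rw [h1] at ih
    rw [h2]
    simp only [List.length_append, List.length_cons] at *
    omega

end push

end AsdimAux

open AsdimAux in
/-- **Theorem 5.** Let `A = G true` and `B = G false` be finitely generated groups with
`asdim A ≤ n` and `asdim B ≤ n`, and let `C` be a common subgroup (embedded in both via
the injective homomorphisms `φ`).  Then the amalgamated free product
`A ∗_C B` (realized as the pushout of `φ`, with the word metric from the union of the
generating sets of `A` and `B`) satisfies `asdim (A ∗_C B) ≤ 2n + 1`. -/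
theorem asdim_amalgamated_product_le {C : Type*} [Group C]
    {G : Bool → Type*} [∀ b, Group (G b)]
    (φ : ∀ b, C →* G b) (hφ : ∀ b, Function.Injective (φ b))
    (S : ∀ b, Finset (G b)) (hS : ∀ b, Subgroup.closure ((S b : Set (G b))) = ⊤)
    (n : ℕ)
    (hA : AsdimOnLE (wordDist ((S true : Set (G true)))) (Set.univ : Set (G true)) n)
    (hB : AsdimOnLE (wordDist ((S false : Set (G false)))) (Set.univ : Set (G false)) n) :
    AsdimOnLE
      (wordDist ((Monoid.PushoutI.of (φ := φ) true) '' (S true : Set (G true)) ∪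
        (Monoid.PushoutI.of (φ := φ) false) '' (S false : Set (G false))))
      (Set.univ : Set (Monoid.PushoutI φ)) (2 * n + 1) := by
  classical
  set U : Set (Monoid.PushoutI φ) := (Monoid.PushoutI.of (φ := φ) true) '' (S true : Set (G true)) ∪
        (Monoid.PushoutI.of (φ := φ) false) '' (S false : Set (G false)) with hU
  have hUfin : U.Finite := ((S true).finite_toSet.image _).union ((S false).finite_toSet.image _)
  have hofU : ∀ b, ∀ t ∈ (S b : Set (G b)), Monoid.PushoutI.of (φ := φ) b t ∈ U := by
    intro b t ht
    cases b
    · exact .inr ⟨t, ht, rfl⟩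
    · exact .inl ⟨t, ht, rfl⟩
  have hofcl : ∀ b (g : G b), Monoid.PushoutI.of (φ := φ) b g ∈ Subgroup.closure U := by
    intro b g
    have hg : g ∈ Subgroup.closure (S b : Set (G b)) := hS b ▸ Subgroup.mem_top g
    have hle : Subgroup.closure (S b : Set (G b)) ≤
        (Subgroup.closure U).comap (Monoid.PushoutI.of (φ := φ) b) := by
      rw [Subgroup.closure_le]
      intro t ht
      exact Subgroup.subset_closure (hofU b t ht)
    exact hle hg
  have hUcl : Subgroup.closure U = ⊤ := by
    rw [eq_top_iff]
    intro x _
    induction x using Monoid.PushoutI.induction_on with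
    | of i g => exact hofcl i g
    | base h =>
      rw [← Monoid.PushoutI.of_apply_eq_base φ true]
      exact hofcl _ _
    | mul x y hx hy => exact mul_mem (hx trivial) (hy trivial)
  have hδ := word_amet hUcl
  obtain ⟨D⟩ := Monoid.PushoutI.NormalWord.transversal_nonempty φ hφ
  have hinj := fun b => Monoid.PushoutI.of_injective hφ b
  have hPA := AAsd_range hUfin hUcl (hS true) (Monoid.PushoutI.of (φ := φ) true) (hinj true)
    (hofU true) (asdim_to_AAsd hA)
  have hPB := AAsd_range hUfin hUcl (hS false) (Monoid.PushoutI.of (φ := φ) false) (hinj false)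
    (hofU false) (asdim_to_AAsd hB)
  let e : Monoid.PushoutI.NormalWord D := Monoid.PushoutI.NormalWord.empty
  let M : Monoid.PushoutI φ → List (Σ i, G i) := fun x => (x⁻¹ • e).toList
  have hform : ∀ x a t, M x = a ++ t → ∃ c : C,
      lprod t * x = (Monoid.PushoutI.base φ c * lprod a)⁻¹ := by
    intro x a t h
    have h1 : (x⁻¹ • e).prod = x⁻¹ := by
      rw [Monoid.PushoutI.NormalWord.prod_smul, Monoid.PushoutI.NormalWord.prod_empty, mul_one]
    refine ⟨(x⁻¹ • e).head, ?_⟩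
    rw [Monoid.PushoutI.NormalWord.prod, ofCoprod_prod] at h1
    have h2 : lprod (φ := φ) (x⁻¹ • e).toList = lprod a * lprod t := by
      have h3 : (x⁻¹ • e).toList = a ++ t := h
      rw [h3]
      simp [lprod]
    rw [h2, ← mul_assoc] at h1
    generalize (Monoid.PushoutI.base φ) (x⁻¹ • e).head = z at h1 ⊢
    have h4 : x = (z * lprod a * lprod t)⁻¹ := by rw [h1, inv_inv]
    rw [h4]
    group
  apply AAsd_to_asdim hUcl
  refine tree_final (wordNorm U) M {g | g ∈ U ∨ g⁻¹ ∈ U}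
    (Set.range (Monoid.PushoutI.of (φ := φ) true) ∪ Set.range (Monoid.PushoutI.of (φ := φ) false))
    hδ n lprod (exists_word hUcl) (fun l hl => wordNorm_le hl) ?_ ?_ ?_ (hPA.union hδ hPB)
  · intro x s hs
    have hs' : ∃ i, ∃ g : G i, s⁻¹ = Monoid.PushoutI.of (φ := φ) i g := by
      rcases hs with (⟨t, _, rfl⟩ | ⟨t, _, rfl⟩) | (⟨t, _, h⟩ | ⟨t, _, h⟩)
      · exact ⟨true, t⁻¹, by simp⟩
      · exact ⟨false, t⁻¹, by simp⟩
      · exact ⟨true, t, h.symm⟩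
      · exact ⟨false, t, h.symm⟩
    obtain ⟨i, g, hg⟩ := hs'
    have h := smul_list i g (x⁻¹ • e)
    rw [← hg, ← mul_smul, ← mul_inv_rev] at h
    exact h
  · intro x a t h ha
    obtain ⟨c, hc⟩ := hform x a t h
    have hr : ∀ i (g : G i), Monoid.PushoutI.of (φ := φ) i g ∈
        Set.range (Monoid.PushoutI.of (φ := φ) true) ∪
          Set.range (Monoid.PushoutI.of (φ := φ) false) := by
      intro i g
      cases i
      · exact .inr ⟨g, rfl⟩
      · exact .inl ⟨g, rfl⟩
    rw [hc]
    rcases a with _ | ⟨⟨i, g⟩, a⟩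
    · have := hr true (φ true c)⁻¹
      rw [map_inv, Monoid.PushoutI.of_apply_eq_base] at this
      simpa [lprod] using this
    · have ha : a = [] := by simpa using ha
      subst ha
      have := hr i (φ i c * g)⁻¹
      rw [map_inv, map_mul, Monoid.PushoutI.of_apply_eq_base] at this
      simpa [lprod] using this
  · intro x a t h
    obtain ⟨c, hc⟩ := hform x a t h
    have h1 := lprod_smul_len (φ := φ) (d := D) a
    simp only [M]
    rw [hc, inv_inv, mul_smul, Monoid.PushoutI.NormalWord.base_smul_def]
    exact h1.trans (Nat.le_succ _)
end
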